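/- arXiv:2202.10183 — 2 statements merged into one kernel-verified Lean document; each statement's English description precedes it below -/
import Mathlib

section
/- Let k < n = |V| and let 𝒥 be the set of k-element subsets of V. For each I ∈ 𝒥 let A_I ∈ B_{V,I}. Suppose there is δ > 0 such that whenever sets B_I ∈ B⁰_{V,I} (I ∈ 𝒥) satisfy ν^V(A_I ∖ B_I) < δ for all I ∈ 𝒥, then ⋂_{I∈𝒥} B_I ≠ ∅. Then ν^V(⋂_{I∈𝒥} A_I) > 0. -/
open FirstOrder MeasureTheory Set
open scoped ENNReal

namespace MeasureAmalgamation

variable (L : FirstOrder.Language) (M : Type*) [L.Structure M]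

/-- `𝓜` is ℵ₁-saturated: every countable finitely satisfiable set of `L`-formulas in one
free variable with parameters from `M` is realized in `M`. -/
def Aleph1Saturated : Prop :=
  ∀ S : Set (L.Formula (M ⊕ Fin 1)), S.Countable →
    (∀ T : Finset (L.Formula (M ⊕ Fin 1)), ↑T ⊆ S →
      ∃ a : M, ∀ φ ∈ T, φ.Realize (Sum.elim id fun _ => a)) →
    ∃ a : M, ∀ φ ∈ S, φ.Realize (Sum.elim id fun _ => a)

/-- The σ-algebra `B_α` generated by the Boolean algebra `B⁰_α` of parameter-definable
subsets of `M^α`. -/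
def defSigma (α : Type*) : MeasurableSpace (α → M) :=
  MeasurableSpace.generateFrom {s : Set (α → M) | (Set.univ : Set M).Definable L s}

variable (n : ℕ)

/-- The projection `π_I : M^V → M^I`. -/
def proj (I : Finset (Fin n)) (x : Fin n → M) : ↥I → M := fun i => x ↑i

/-- The Boolean algebra `B⁰_{V,I}` generated by preimages under `π_I` of sets in `B⁰_I`. -/
def cylDef (I : Finset (Fin n)) : Set (Set (Fin n → M)) :=
  {s | ∃ t : Set (↥I → M), (Set.univ : Set M).Definable L t ∧ s = proj M n I ⁻¹' t}

/-- The σ-algebra `B_{V,I}` generated by `B⁰_{V,I}`. -/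
def cylSigma (I : Finset (Fin n)) : MeasurableSpace (Fin n → M) :=
  MeasurableSpace.generateFrom (cylDef L M n I)

/-- The push-forward measure `ν^I` of `ν = ν^V` under `π_I`. -/
noncomputable def nuI (ν : @Measure (Fin n → M) (defSigma L M (Fin n)))
    (I : Finset (Fin n)) : @Measure (↥I → M) (defSigma L M ↥I) :=
  @Measure.map _ _ (defSigma L M (Fin n)) (defSigma L M ↥I) (proj M n I) ν

/-- Combining a `W`-tuple and a `(V ∖ W)`-tuple into a `V`-tuple. -/
def glue (W : Finset (Fin n)) (x : ↥W → M) (y : ↥(Wᶜ) → M) : Fin n → M :=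
  fun i => if h : i ∈ W then x ⟨i, h⟩ else y ⟨i, Finset.mem_compl.mpr h⟩

/-- The Definability condition: for all `W ⊆ V` and `B ∈ B_V`, the function
`x_W ↦ ν^{V∖W}(B(x_W))` is `B_W`-measurable. -/
def DefinabilityCond (ν : @Measure (Fin n → M) (defSigma L M (Fin n))) : Prop :=
  ∀ (W : Finset (Fin n)) (B : Set (Fin n → M)),
    MeasurableSet[defSigma L M (Fin n)] B →
    @Measurable _ _ (defSigma L M ↥W) _
      (fun x : ↥W → M => nuI L M n ν Wᶜ {y : ↥(Wᶜ) → M | glue M n W x y ∈ B})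

/-- The Fubini condition: for all `W ⊆ V` and essentially bounded `B_V`-measurable
`f : M^V → ℝ`, `∫ f dν^V = ∫∫ f dν^W dν^{V∖W}`. -/
def FubiniCond (ν : @Measure (Fin n → M) (defSigma L M (Fin n))) : Prop :=
  ∀ (W : Finset (Fin n)) (f : (Fin n → M) → ℝ),
    @Measurable _ _ (defSigma L M (Fin n)) _ f →
    (∃ C : ℝ, ∀ᵐ x ∂ν, |f x| ≤ C) →
    ∫ x, f x ∂ν =
      ∫ y, (∫ x, f (glue M n W x y) ∂(nuI L M n ν W)) ∂(nuI L M n ν Wᶜ)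

/-- Abstract system of cylinder algebras, with the consequences of Fubini used in the proof. -/
structure Sys {X : Type*} [MeasurableSpace X] (ν : Measure X) (n : ℕ)
    (cyl : Finset (Fin n) → Set (Set X)) : Prop where
  alg : ∀ I, IsSetAlgebra (cyl I)
  mono : ∀ I J, I ⊆ J → cyl I ⊆ cyl J
  meas : ∀ I, ∀ s ∈ cyl I, MeasurableSet s
  bot : ∀ s ∈ cyl ∅, s = ∅ ∨ s = univ
  fub : ∀ I, ∃ Φ : Set (X → X),
    (∀ φ ∈ Φ, ∀ K, ∀ s ∈ cyl K, φ ⁻¹' s ∈ cyl (K ∩ I)) ∧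
    (∀ φ ∈ Φ, ∀ s ∈ cyl I, φ ⁻¹' s = s) ∧
    ∀ f : X → ℝ, Measurable f → (∃ C, ∀ x, |f x| ≤ C) → (∀ φ ∈ Φ, ∫ x, f (φ x) ∂ν ≤ 0) →
      ∫ x, f x ∂ν ≤ 0

/-- Generators of the σ-algebra of `I`-sets of complexity at most `j`. -/
def gens {X : Type*} {n : ℕ} (cyl : Finset (Fin n) → Set (Set X)) (I : Finset (Fin n)) (j : ℕ) :
    Set (Set X) := {s | ∃ K, K ⊆ I ∧ K.card ≤ j ∧ s ∈ cyl K}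

/-- The σ-algebra of `I`-sets of complexity at most `j`. -/
abbrev mm {X : Type*} {n : ℕ} (cyl : Finset (Fin n) → Set (Set X)) (I : Finset (Fin n)) (j : ℕ) :
    MeasurableSpace X := MeasurableSpace.generateFrom (gens cyl I j)

theorem Sys.mm_le {X : Type*} [mX : MeasurableSpace X] {ν : Measure X} {n : ℕ}
    {cyl : Finset (Fin n) → Set (Set X)} (h : Sys ν n cyl) (I : Finset (Fin n)) (j : ℕ) :
    mm cyl I j ≤ mX := by
  apply MeasurableSpace.generateFrom_le
  rintro s ⟨K, -, -, hs⟩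
  exact h.meas K s hs

theorem mm_mono {X : Type*} {n : ℕ}
    {cyl : Finset (Fin n) → Set (Set X)} (I : Finset (Fin n)) (j : ℕ) :
    mm cyl I j ≤ mm cyl I (j + 1) := by
  apply MeasurableSpace.generateFrom_mono
  rintro s ⟨K, h1, h2, hs⟩
  exact ⟨K, h1, by omega, hs⟩

/-- Hahn decomposition relative to a sub-σ-algebra. -/
theorem hahn_sub {X : Type*} [mX : MeasurableSpace X] (ν : Measure X) [IsFiniteMeasure ν]
    (m : MeasurableSpace X) (hm : m ≤ mX) (a : NNReal) (G H : Set X) :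
    ∃ D, MeasurableSet[m] D ∧
      (∀ T, MeasurableSet[m] T → T ⊆ D → a * ν (T ∩ G) ≤ ν (T ∩ H)) ∧
      (∀ T, MeasurableSet[m] T → T ⊆ Dᶜ → ν (T ∩ H) ≤ a * ν (T ∩ G)) := by
  obtain ⟨D, hD, h1, h2⟩ := @hahn_decomposition X m ((ν.restrict H).trim hm)
    ((a • ν.restrict G).trim hm) _ _
  have e1 : ∀ T, MeasurableSet[m] T → (ν.restrict H).trim hm T = ν (T ∩ H) := fun T hT => by
    rw [trim_measurableSet_eq hm hT, Measure.restrict_apply (hm _ hT)]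
  have e2 : ∀ T, MeasurableSet[m] T → (a • ν.restrict G).trim hm T = a * ν (T ∩ G) :=
    fun T hT => by
      rw [trim_measurableSet_eq hm hT, Measure.smul_apply, Measure.restrict_apply (hm _ hT)]
      rfl
  refine ⟨D, hD, fun T hT hTD => ?_, fun T hT hTD => ?_⟩
  · rw [← e1 T hT, ← e2 T hT]; exact h1 T hT hTD
  · rw [← e1 T hT, ← e2 T hT]; exact h2 T hT hTD

/-- `R` has all its `I`-sections in `m`: abstract version. -/
def SecMeas {X : Type*} (Φ : Set (X → X)) (m : MeasurableSpace X) (R : Set X) : Prop :=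
  ∀ φ ∈ Φ, MeasurableSet[m] (φ ⁻¹' R)

theorem preimage_eq_of_gen {X : Type*} {S : Set (Set X)} (φ : X → X)
    (hφ : ∀ s ∈ S, φ ⁻¹' s = s) (s : Set X) (hs : MeasurableSet[MeasurableSpace.generateFrom S] s) :
    φ ⁻¹' s = s := by
  induction s, hs using MeasurableSpace.generateFrom_induction with
  | hC t ht _ => exact hφ t ht
  | empty => simp
  | compl t _ ih => rw [preimage_compl, ih]
  | iUnion f _ ih => rw [preimage_iUnion]; simp [ih]

theorem key {X : Type*} [mX : MeasurableSpace X] {ν : Measure X} [IsProbabilityMeasure ν] {n : ℕ}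
    {cyl : Finset (Fin n) → Set (Set X)} (I : Finset (Fin n)) (j : ℕ)
    (Φ : Set (X → X))
    (hfub : ∀ f : X → ℝ, Measurable f → (∃ C, ∀ x, |f x| ≤ C) →
      (∀ φ ∈ Φ, ∫ x, f (φ x) ∂ν ≤ 0) → ∫ x, f x ∂ν ≤ 0)
    (hm : mm cyl I j ≤ mX)
    (a : NNReal) (G H D R : Set X) (hG : MeasurableSet G) (hH : MeasurableSet H)
    (hGI : ∀ φ ∈ Φ, φ ⁻¹' G = G) (hHI : ∀ φ ∈ Φ, φ ⁻¹' H = H) (hDI : ∀ φ ∈ Φ, φ ⁻¹' D = D)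
    (hD : ∀ T, MeasurableSet[mm cyl I j] T → T ⊆ D → a * ν (T ∩ G) ≤ ν (T ∩ H))
    (hR : MeasurableSet R) (hRD : R ⊆ D) (hRs : SecMeas Φ (mm cyl I j) R) :
    a * ν (R ∩ G) ≤ ν (R ∩ H) := by
  have hsetint : ∀ S G H : Set X, MeasurableSet S → MeasurableSet G → MeasurableSet H →
      ∫ x, ((a : ℝ) * (S ∩ G).indicator (fun _ => (1 : ℝ)) x
        - (S ∩ H).indicator (fun _ => (1 : ℝ)) x) ∂ν = a * ν.real (S ∩ G) - ν.real (S ∩ H) := by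
    intro S G H hS hG hH
    rw [integral_sub, integral_const_mul, integral_indicator_const _ (hS.inter hG),
      integral_indicator_const _ (hS.inter hH)]
    · simp
    · exact ((integrable_const (1 : ℝ)).indicator (hS.inter hG)).const_mul _
    · exact ((integrable_const (1 : ℝ)).indicator (hS.inter hH))
  have hconv : ∀ S : Set X, (a * ν (S ∩ G) ≤ ν (S ∩ H)) ↔
      ((a : ℝ) * ν.real (S ∩ G) - ν.real (S ∩ H) ≤ 0) := by
    intro S
    rw [sub_nonpos, ← ENNReal.toReal_le_toReal (by finiteness) (by finiteness)]
    simp [Measure.real]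
  rw [hconv, ← hsetint R G H hR hG hH]
  apply hfub
  · exact ((measurable_const.indicator (hR.inter hG)).const_mul _).sub
      (measurable_const.indicator (hR.inter hH))
  · refine ⟨a + 1, fun x => ?_⟩
    refine (abs_sub _ _).trans ?_
    have h1 : ∀ S : Set X, |S.indicator (fun _ => (1 : ℝ)) x| ≤ 1 := by
      intro S
      by_cases hx : x ∈ S <;> simp [hx]
    rw [abs_mul]
    have := h1 (R ∩ G)
    have := h1 (R ∩ H)
    have ha : |(a : ℝ)| = a := abs_of_nonneg a.2
    rw [ha]
    have := mul_le_mul_of_nonneg_left (h1 (R ∩ G)) a.2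
    simp only [NNReal.val_eq_coe, mul_one] at this
    linarith
  · intro φ hφ
    have e : ∀ G : Set X, φ ⁻¹' G = G → ∀ x, (R ∩ G).indicator (fun _ => (1 : ℝ)) (φ x)
        = (φ ⁻¹' R ∩ G).indicator (fun _ => (1 : ℝ)) x := by
      intro G hG x
      conv_rhs => rw [← hG, ← preimage_inter]
      rfl
    simp_rw [e G (hGI φ hφ), e H (hHI φ hφ)]
    rw [hsetint _ G H (hm _ (hRs φ hφ)) hG hH, ← hconv]
    apply hD _ (hRs φ hφ)
    rw [← hDI φ hφ]
    exact preimage_mono hRD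

/-- Sets determined by finitely many generators. -/
def finDet {X : Type*} (S : Set (Set X)) : Set (Set X) :=
  {C | MeasurableSet[MeasurableSpace.generateFrom S] C ∧ ∃ F : Finset (Set X), (F : Set (Set X)) ⊆ S ∧
    ∀ x y, (∀ s ∈ F, x ∈ s ↔ y ∈ s) → (x ∈ C ↔ y ∈ C)}

theorem approx {X : Type*} [mX : MeasurableSpace X] (ν : Measure X) [IsFiniteMeasure ν]
    (S : Set (Set X)) (hm : MeasurableSpace.generateFrom S ≤ mX) (A : Set X)
    (hA : MeasurableSet[MeasurableSpace.generateFrom S] A) (η : ℝ≥0∞) (hη : 0 < η) :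
    ∃ C ∈ finDet S, ν (A \ C) ≤ η ∧ ν (C \ A) ≤ η := by
  classical
  have halg : IsSetAlgebra (finDet S) := by
    refine ⟨⟨@MeasurableSet.empty X (MeasurableSpace.generateFrom S), ∅, by simp, by simp⟩, ?_, ?_⟩
    · rintro s ⟨hs, F, hF, h⟩
      refine ⟨hs.compl, F, hF, fun x y hxy => ?_⟩
      rw [mem_compl_iff, mem_compl_iff, h x y hxy]
    · rintro s t ⟨hs, F, hF, h⟩ ⟨hs', F', hF', h'⟩
      refine ⟨hs.union hs', F ∪ F', by simp [hF, hF'], fun x y hxy => ?_⟩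
      rw [mem_union, mem_union, h x y fun s hs => hxy s (by simp [hs]),
        h' x y fun s hs => hxy s (by simp [hs])]
  have hgen : MeasurableSpace.generateFrom S = MeasurableSpace.generateFrom (finDet S) := by
    apply le_antisymm
    · apply MeasurableSpace.generateFrom_mono
      intro s hs
      refine ⟨MeasurableSpace.measurableSet_generateFrom hs, {s}, by simpa using hs, ?_⟩
      intro x y h
      exact h s (by simp)
    · apply MeasurableSpace.generateFrom_le
      rintro s ⟨hs, -⟩
      exact hs
  have hcov : ∃ D : Set (Set X), D.Countable ∧ D ⊆ finDet S ∧ (ν.trim hm) (⋃₀ D)ᶜ = 0 :=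
    ⟨{univ}, countable_singleton _, by simpa using halg.univ_mem, by
      rw [sUnion_singleton, compl_univ, measure_empty]⟩
  obtain ⟨C, hC, h⟩ := @exists_measure_symmDiff_lt_of_generateFrom_isSetRing X
    (MeasurableSpace.generateFrom S) (ν.trim hm) _ (finDet S) halg.isSetRing
    hcov hgen A hA η hη
  rw [trim_measurableSet_eq hm (@MeasurableSet.symmDiff X (MeasurableSpace.generateFrom S) _ _ hC.1 hA)] at h
  refine ⟨C, hC, (measure_mono ?_).trans h.le, (measure_mono ?_).trans h.le⟩
  · exact subset_union_right
  · exact subset_union_left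

theorem SecMeas.inter {X : Type*} {Φ : Set (X → X)} {m : MeasurableSpace X} {R S : Set X}
    (hR : SecMeas Φ m R) (hS : SecMeas Φ m S) : SecMeas Φ m (R ∩ S) :=
  fun φ hφ => (hR φ hφ).inter (hS φ hφ)

theorem SecMeas.iInter {X : Type*} {ι : Sort*} [Countable ι] {Φ : Set (X → X)}
    {m : MeasurableSpace X} {R : ι → Set X}
    (hR : ∀ i, SecMeas Φ m (R i)) : SecMeas Φ m (⋂ i, R i) := by
  intro φ hφ
  rw [preimage_iInter]
  exact MeasurableSet.iInter fun i => hR i φ hφ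

theorem secMeas_cyl {X : Type*} {n : ℕ} {cyl : Finset (Fin n) → Set (Set X)}
    {Φ : Set (X → X)} {I : Finset (Fin n)}
    (hΦ : ∀ φ ∈ Φ, ∀ K, ∀ s ∈ cyl K, φ ⁻¹' s ∈ cyl (K ∩ I)) {j : ℕ} {K : Finset (Fin n)}
    {s : Set X} (hs : s ∈ cyl K) (hK : (K ∩ I).card ≤ j) : SecMeas Φ (mm cyl I j) s := by
  intro φ hφ
  exact MeasurableSpace.measurableSet_generateFrom
    ⟨K ∩ I, Finset.inter_subset_right, hK, hΦ φ hφ K s hs⟩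

theorem secMeas_mm {X : Type*} {n : ℕ} {cyl : Finset (Fin n) → Set (Set X)}
    {Φ : Set (X → X)} {I : Finset (Fin n)}
    (hΦ : ∀ φ ∈ Φ, ∀ K, ∀ s ∈ cyl K, φ ⁻¹' s ∈ cyl (K ∩ I)) {j : ℕ} {K : Finset (Fin n)}
    {s : Set X} (hs : MeasurableSet[mm cyl K j] s) : SecMeas Φ (mm cyl I j) s := by
  intro φ hφ
  have : @Measurable X X (mm cyl I j) (mm cyl K j) φ := by
    refine @measurable_generateFrom X X (mm cyl I j) _ _ ?_
    rintro t ⟨K', -, h2, h3⟩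
    exact secMeas_cyl hΦ h3 ((Finset.card_le_card Finset.inter_subset_left).trans h2) φ hφ
  exact this hs

theorem Sys.gens_sub {X : Type*} [mX : MeasurableSpace X] {ν : Measure X} {n : ℕ}
    {cyl : Finset (Fin n) → Set (Set X)} (h : Sys ν n cyl) (I : Finset (Fin n)) (j : ℕ) :
    gens cyl I j ⊆ cyl I := by
  rintro s ⟨K, h1, -, hs⟩
  exact h.mono _ _ h1 hs

theorem IsSetAlgebra.iInter_mem {X : Type*} {𝒜 : Set (Set X)} (h : IsSetAlgebra 𝒜) {ι : Type*}
    [Finite ι] {s : ι → Set X} (hs : ∀ i, s i ∈ 𝒜) : ⋂ i, s i ∈ 𝒜 := by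
  classical
  cases nonempty_fintype ι
  simpa using h.biInter_mem Finset.univ (fun i _ => hs i)

theorem IsSetAlgebra.iInter_prop_mem {X : Type*} {𝒜 : Set (Set X)} (h : IsSetAlgebra 𝒜) {P : Prop}
    {s : P → Set X} (hs : ∀ i, s i ∈ 𝒜) : ⋂ i, s i ∈ 𝒜 := by
  by_cases hP : P
  · simpa [hP] using hs hP
  · simpa [hP] using h.univ_mem

/-- The cell of a colour pattern `p` seen from `I`. -/
def cell {X κ : Type*} {n : ℕ} (c : Finset (Fin n) → X → κ) (j : ℕ) (p : Finset (Fin n) → κ)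
    (I : Finset (Fin n)) : Set X :=
  ⋂ J, ⋂ (_ : J ⊆ I ∧ J.card ≤ j + 1), c J ⁻¹' {p J}

theorem mem_cell {X κ : Type*} {n : ℕ} {c : Finset (Fin n) → X → κ} {j : ℕ}
    {p : Finset (Fin n) → κ} {I : Finset (Fin n)} {x : X} :
    x ∈ cell c j p I ↔ ∀ J, J ⊆ I → J.card ≤ j + 1 → c J x = p J := by
  simp [cell]

theorem Sys.cell_mem {X κ : Type*} [mX : MeasurableSpace X] {ν : Measure X} {n : ℕ}
    {cyl : Finset (Fin n) → Set (Set X)} (h : Sys ν n cyl) {c : Finset (Fin n) → X → κ}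
    (hc : ∀ J v, c J ⁻¹' {v} ∈ cyl J) (j : ℕ) (p : Finset (Fin n) → κ)
    (I : Finset (Fin n)) : cell c j p I ∈ cyl I := by
  refine IsSetAlgebra.iInter_mem (h.alg I) fun J => IsSetAlgebra.iInter_prop_mem (h.alg I) fun hJ => ?_
  exact h.mono J I hJ.1 (hc J _)

theorem zero1 {X κ : Type*} [mX : MeasurableSpace X] {ν : Measure X} [IsProbabilityMeasure ν]
    {n : ℕ} {cyl : Finset (Fin n) → Set (Set X)} (h : Sys ν n cyl) {c : Finset (Fin n) → X → κ}
    (hc : ∀ J v, c J ⁻¹' {v} ∈ cyl J) (j k : ℕ) (p : Finset (Fin n) → κ)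
    (A D : Finset (Fin n) → Set X)
    (hA : ∀ I, I.card ≤ k → MeasurableSet[mm cyl I (j + 1)] (A I))
    (hA0 : ν {x | ∀ I, I.card ≤ k → x ∈ A I} = 0)
    (hD : ∀ I, I.card ≤ k → MeasurableSet[mm cyl I j] (D I))
    (hDQ : ∀ I, I.card ≤ k → ∀ T, MeasurableSet[mm cyl I j] T → T ⊆ D I →
      ((Fintype.card (Finset (Fin n)) + 1 : ℕ) : NNReal) * ν (T ∩ (cell c j p I \ A I))
        ≤ ν (T ∩ cell c j p I)) :
    ν ((⋂ J, ⋂ (_ : J.card ≤ j + 1), c J ⁻¹' {p J}) ∩ ⋂ I, ⋂ (_ : I.card ≤ k), D I) = 0 := by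
  set N := Fintype.card (Finset (Fin n)) with hN
  set Z := (⋂ J, ⋂ (_ : J.card ≤ j + 1), c J ⁻¹' {p J}) ∩ ⋂ I, ⋂ (_ : I.card ≤ k), D I with hZ
  have hmD : ∀ I, I.card ≤ k → MeasurableSet (D I) := fun I hI => h.mm_le I j _ (hD I hI)
  have hmA : ∀ I, I.card ≤ k → MeasurableSet (A I) := fun I hI => h.mm_le I (j + 1) _ (hA I hI)
  have main : ∀ I, I.card ≤ k → ((N + 1 : ℕ) : ℝ≥0∞) * ν (Z \ A I) ≤ ν Z := by
    intro I hI
    obtain ⟨Φ, h1, h2, h3⟩ := h.fub I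
    have hinv : ∀ j', ∀ s, MeasurableSet[mm cyl I j'] s → ∀ φ ∈ Φ, φ ⁻¹' s = s := by
      intro j' s hs φ hφ
      exact preimage_eq_of_gen φ (fun t ht => h2 φ hφ t (h.gens_sub I j' ht)) s hs
    have hQ := h.cell_mem hc j p I
    set R := (⋂ J, ⋂ (_ : J.card ≤ j + 1 ∧ ¬ J ⊆ I), c J ⁻¹' {p J}) ∩
      ⋂ I, ⋂ (_ : I.card ≤ k), D I with hRdef
    have hk := key (cyl := cyl) I j Φ h3 (h.mm_le I j) ((N + 1 : ℕ) : NNReal)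
      (cell c j p I \ A I) (cell c j p I) (D I) R
      ((h.meas I _ hQ).diff (hmA I hI)) (h.meas I _ hQ)
      (fun φ hφ => by rw [preimage_sdiff, h2 φ hφ _ hQ, hinv _ _ (hA I hI) φ hφ])
      (fun φ hφ => h2 φ hφ _ hQ) (hinv _ _ (hD I hI)) (hDQ I hI)
      ?_ ?_ ?_
    · have e1 : R ∩ cell c j p I = Z := by
        ext x
        simp only [hRdef, hZ, mem_inter_iff, mem_iInter, mem_cell, mem_preimage, mem_singleton_iff]
        constructor
        · rintro ⟨⟨a, b⟩, d⟩
          refine ⟨fun J hJ => ?_, b⟩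
          by_cases hJI : J ⊆ I
          · exact d J hJI hJ
          · exact a J ⟨hJ, hJI⟩
        · rintro ⟨a, b⟩
          exact ⟨⟨fun J hJ => a J hJ.1, b⟩, fun J _ hJ => a J hJ⟩
      have e2 : R ∩ (cell c j p I \ A I) = Z \ A I := by
        rw [← e1, inter_sdiff_assoc]
      rw [e1, e2] at hk
      simpa using hk
    · refine MeasurableSet.inter ?_ ?_
      · exact MeasurableSet.iInter fun J => MeasurableSet.iInter fun _ => h.meas J _ (hc J _)
      · exact MeasurableSet.iInter fun J => MeasurableSet.iInter fun hJ => hmD J hJ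
    · intro x hx
      have := hx.2
      simp only [mem_iInter] at this
      exact this I hI
    · refine SecMeas.inter ?_ ?_
      · refine SecMeas.iInter fun J => SecMeas.iInter fun hJ => secMeas_cyl h1 (hc J _) ?_
        have : (J ∩ I).card < J.card := by
          apply Finset.card_lt_card
          refine ⟨Finset.inter_subset_left, fun hh => hJ.2 ?_⟩
          exact hh.trans Finset.inter_subset_right
        omega
      · exact SecMeas.iInter fun J => SecMeas.iInter fun hJ => secMeas_mm h1 (hD J hJ)
  have hZle : ν Z ≤ ∑ I ∈ Finset.univ.filter (fun I : Finset (Fin n) => I.card ≤ k), ν (Z \ A I) := by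
    have hsub : Z ⊆ {x | ∀ I, I.card ≤ k → x ∈ A I} ∪
        ⋃ I ∈ Finset.univ.filter (fun I : Finset (Fin n) => I.card ≤ k), Z \ A I := by
      intro x hx
      by_cases hxA : ∀ I, I.card ≤ k → x ∈ A I
      · exact Or.inl hxA
      · push Not at hxA
        obtain ⟨I, hI, hxI⟩ := hxA
        refine Or.inr ?_
        simp only [mem_iUnion]
        exact ⟨I, by simpa using hI, hx, hxI⟩
    refine (measure_mono hsub).trans ((measure_union_le _ _).trans ?_)
    rw [hA0, zero_add]
    exact measure_biUnion_finset_le _ _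
  have h2 : ((N + 1 : ℕ) : ℝ≥0∞) * ν Z ≤ N * ν Z := by
    calc ((N + 1 : ℕ) : ℝ≥0∞) * ν Z
        ≤ ((N + 1 : ℕ) : ℝ≥0∞) *
          ∑ I ∈ Finset.univ.filter (fun I : Finset (Fin n) => I.card ≤ k), ν (Z \ A I) := by gcongr
      _ = ∑ I ∈ Finset.univ.filter (fun I : Finset (Fin n) => I.card ≤ k),
          ((N + 1 : ℕ) : ℝ≥0∞) * ν (Z \ A I) := Finset.mul_sum _ _ _
      _ ≤ ∑ I ∈ Finset.univ.filter (fun I : Finset (Fin n) => I.card ≤ k), ν Z := by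
          apply Finset.sum_le_sum
          intro I hI
          exact main I (by simpa using hI)
      _ ≤ ∑ I : Finset (Fin n), ν Z := Finset.sum_le_sum_of_subset (Finset.filter_subset _ _)
      _ = N * ν Z := by simp [hN]
  have hfin : (N : ℝ≥0∞) * ν Z ≠ ⊤ := by finiteness
  rw [Nat.cast_succ, add_mul, one_mul] at h2
  have h3 : (N : ℝ≥0∞) * ν Z + ν Z ≤ N * ν Z + 0 := by simpa using h2
  simpa using (ENNReal.add_le_add_iff_left hfin).1 h3

theorem zero2 {X κ : Type*} [mX : MeasurableSpace X] {ν : Measure X} [IsProbabilityMeasure ν]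
    {n : ℕ} {cyl : Finset (Fin n) → Set (Set X)} (h : Sys ν n cyl) {c : Finset (Fin n) → X → κ}
    (hc : ∀ J v, c J ⁻¹' {v} ∈ cyl J) (j k : ℕ) (p : Finset (Fin n) → κ)
    (D S : Finset (Fin n) → Set X)
    (hD : ∀ I, I.card ≤ k → MeasurableSet[mm cyl I j] (D I))
    (h0 : ν ((⋂ J, ⋂ (_ : J.card ≤ j + 1), c J ⁻¹' {p J}) ∩ ⋂ I, ⋂ (_ : I.card ≤ k), D I) = 0)
    (ε : NNReal) (hε : 0 < ε)
    (hS : ∀ I, MeasurableSet[mm cyl I j] (S I))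
    (hSc : ∀ I, ∀ T, MeasurableSet[mm cyl I j] T → T ⊆ S I →
      ε * ν (T ∩ univ) ≤ ν (T ∩ c I ⁻¹' {p I})) :
    ν ((⋂ J, ⋂ (_ : J.card ≤ j + 1), S J) ∩ ⋂ I, ⋂ (_ : I.card ≤ k), D I) = 0 := by
  classical
  have hmD : ∀ I, I.card ≤ k → MeasurableSet (D I) := fun I hI => h.mm_le I j _ (hD I hI)
  have hmS : ∀ I, MeasurableSet (S I) := fun I => h.mm_le I j _ (hS I)
  have main : ∀ T : Finset (Finset (Fin n)),
      ν ((⋂ J, ⋂ (_ : J.card ≤ j + 1), if J ∈ T then S J else c J ⁻¹' {p J}) ∩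
        ⋂ I, ⋂ (_ : I.card ≤ k), D I) = 0 := by
    intro T
    induction T using Finset.induction_on with
    | empty => simpa using h0
    | insert I T hIT ih =>
      by_cases hI : I.card ≤ j + 1
      · obtain ⟨Φ, h1, h2, h3⟩ := h.fub I
        set R0 := (⋂ J, ⋂ (_ : J.card ≤ j + 1 ∧ J ≠ I), if J ∈ T then S J else c J ⁻¹' {p J}) ∩
          ⋂ I, ⋂ (_ : I.card ≤ k), D I with hR0
        have hk := key (cyl := cyl) I j Φ h3 (h.mm_le I j) ε univ (c I ⁻¹' {p I}) (S I) (R0 ∩ S I)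
          MeasurableSet.univ (h.meas I _ (hc I _)) (fun _ _ => preimage_univ)
          (fun φ hφ => h2 φ hφ _ (hc I _))
          (fun φ hφ => preimage_eq_of_gen φ (fun t ht => h2 φ hφ t (h.gens_sub I j ht)) _ (hS I))
          (hSc I) ?_ inter_subset_right ?_
        · have hz : ν ((R0 ∩ S I) ∩ c I ⁻¹' {p I}) = 0 := by
            refine measure_mono_null ?_ ih
            rintro x ⟨⟨⟨a, b⟩, -⟩, d⟩
            refine ⟨?_, b⟩
            simp only [mem_iInter] at a ⊢
            intro J hJ
            by_cases hJI : J = I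
            · subst hJI
              simpa [hIT] using d
            · exact a J ⟨hJ, hJI⟩
          rw [hz, inter_univ] at hk
          have hz2 : ν (R0 ∩ S I) = 0 := by
            have := le_antisymm hk zero_le
            rcases mul_eq_zero.1 this with h' | h'
            · exact absurd (by simpa using h') hε.ne'
            · exact h'
          refine measure_mono_null ?_ hz2
          rintro x ⟨a, b⟩
          simp only [mem_iInter] at a
          refine ⟨⟨?_, b⟩, ?_⟩
          · simp only [mem_iInter]
            intro J hJ
            have := a J hJ.1
            simpa [Finset.mem_insert, hJ.2] using this
          · simpa using a I hI
        · refine MeasurableSet.inter (MeasurableSet.inter ?_ ?_) (hmS I)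
          · refine MeasurableSet.iInter fun J => MeasurableSet.iInter fun _ => ?_
            split_ifs
            · exact hmS J
            · exact h.meas J _ (hc J _)
          · exact MeasurableSet.iInter fun J => MeasurableSet.iInter fun hJ => hmD J hJ
        · refine SecMeas.inter (SecMeas.inter ?_ ?_) (secMeas_mm h1 (hS I))
          · refine SecMeas.iInter fun J => SecMeas.iInter fun hJ => ?_
            split_ifs
            · exact secMeas_mm h1 (hS J)
            · refine secMeas_cyl h1 (hc J _) ?_
              by_contra hcon
              have e1 : J ∩ I = J := Finset.eq_of_subset_of_card_le Finset.inter_subset_left (by omega)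
              have e2 : J ∩ I = I := Finset.eq_of_subset_of_card_le Finset.inter_subset_right (by omega)
              exact hJ.2 (e1.symm.trans e2)
          · exact SecMeas.iInter fun J => SecMeas.iInter fun hJ => secMeas_mm h1 (hD J hJ)
      · refine measure_mono_null ?_ ih
        rintro x ⟨a, b⟩
        refine ⟨?_, b⟩
        simp only [mem_iInter] at a ⊢
        intro J hJ
        have hJI : J ≠ I := by rintro rfl; exact hI hJ
        simpa [Finset.mem_insert, hJI] using a J hJ
  simpa using main Finset.univ

universe u

theorem exists_coloring {X : Type u} [mX : MeasurableSpace X] {ν : Measure X} {n : ℕ}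
    {cyl : Finset (Fin n) → Set (Set X)} (h : Sys ν n cyl) (j : ℕ)
    (C : Finset (Fin n) → Set X) (hC : ∀ I, C I ∈ finDet (gens cyl I (j + 1))) :
    ∃ (κ : Type u) (_ : Finite κ) (_ : Inhabited κ) (c : Finset (Fin n) → X → κ),
      (∀ J v, c J ⁻¹' {v} ∈ cyl J) ∧
      ∀ I x y, (∀ J, J ⊆ I → J.card ≤ j + 1 → c J x = c J y) → (x ∈ C I ↔ y ∈ C I) := by
  classical
  choose hm F hF hdet using hC
  refine ⟨↥(Finset.univ.biUnion F) → Prop, inferInstance, inferInstance, fun J x s => (s : Set X) ∈ cyl J ∧ x ∈ (s : Set X), ?_, ?_⟩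
  · intro J v
    have e : (fun (x : X) (s : ↥(Finset.univ.biUnion F)) => (s : Set X) ∈ cyl J ∧ x ∈ (s : Set X))
        ⁻¹' {v} = ⋂ s : ↥(Finset.univ.biUnion F),
          {x | ((s : Set X) ∈ cyl J ∧ x ∈ (s : Set X)) ↔ v s} := by
      ext x
      simp only [mem_preimage, mem_singleton_iff, mem_iInter, funext_iff, mem_ofPred_eq, eq_iff_iff]
    rw [e]
    refine IsSetAlgebra.iInter_mem (h.alg J) fun s => ?_
    by_cases hs : (s : Set X) ∈ cyl J
    · by_cases hv : v s
      · convert hs using 1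
        ext x
        simp [hs, hv]
      · convert (h.alg J).compl_mem hs using 1
        ext x
        simp [hs, hv]
    · by_cases hv : v s
      · convert (h.alg J).empty_mem using 1
        ext x
        simp [hs, hv]
      · convert (h.alg J).univ_mem using 1
        ext x
        simp [hs, hv]
  · intro I x y hxy
    refine hdet I x y fun s hs => ?_
    obtain ⟨K, hK1, hK2, hsK⟩ := hF I hs
    have := congrFun (hxy K hK1 hK2) ⟨s, Finset.mem_biUnion.2 ⟨I, Finset.mem_univ _, hs⟩⟩
    simpa [hsK] using this

/-- The inductive statement. -/
def TT {X : Type*} [MeasurableSpace X] (ν : Measure X) {n : ℕ}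
    (cyl : Finset (Fin n) → Set (Set X)) (k j : ℕ) : Prop :=
  ∀ A : Finset (Fin n) → Set X, (∀ I, I.card ≤ k → MeasurableSet[mm cyl I j] (A I)) →
    ν {x | ∀ I, I.card ≤ k → x ∈ A I} = 0 → ∀ δ : ℝ≥0∞, 0 < δ →
    ∃ B : Finset (Fin n) → Set X, (∀ I, B I ∈ cyl I) ∧
      (∀ I, I.card ≤ k → ν (A I \ B I) ≤ δ) ∧ ∀ x, ∃ I, I.card ≤ k ∧ x ∉ B I

theorem TT_zero {X : Type*} [mX : MeasurableSpace X] {ν : Measure X} [IsProbabilityMeasure ν]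
    {n : ℕ} {cyl : Finset (Fin n) → Set (Set X)} (h : Sys ν n cyl) (k : ℕ) : TT ν cyl k 0 := by
  classical
  intro A hA h0 δ hδ
  have hA' : ∀ I, I.card ≤ k → A I = ∅ ∨ A I = univ := by
    intro I hI
    have := hA I hI
    generalize A I = a at this
    induction a, this using MeasurableSpace.generateFrom_induction with
    | hC t ht _ =>
      obtain ⟨K, -, hK, ht⟩ := ht
      have : K = ∅ := by simpa using hK
      subst this
      exact h.bot t ht
    | empty => exact Or.inl rfl
    | compl t _ ih => rcases ih with rfl | rfl <;> simp
    | iUnion f _ ih =>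
      by_cases hf : ∃ i, f i = univ
      · obtain ⟨i, hi⟩ := hf
        right
        exact eq_univ_of_univ_subset (hi ▸ subset_iUnion f i)
      · left
        push Not at hf
        simp only [iUnion_eq_empty]
        intro i
        exact (ih i).resolve_right (hf i)
  refine ⟨fun I => if I.card ≤ k then A I else univ, ?_, ?_, ?_⟩
  · intro I
    dsimp only
    split_ifs with hI
    · rcases hA' I hI with e | e <;> rw [e]
      · exact (h.alg I).empty_mem
      · exact (h.alg I).univ_mem
    · exact (h.alg I).univ_mem
  · intro I hI
    simp [hI]
  · by_contra! hcon
    obtain ⟨x, hx⟩ := hcon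
    have : {x | ∀ I, I.card ≤ k → x ∈ A I} = univ := by
      ext y
      simp only [mem_ofPred_eq, mem_univ, iff_true]
      intro I hI
      have := hx I hI
      simp only [hI, if_true] at this
      rcases hA' I hI with e | e
      · rw [e] at this; exact this.elim
      · rw [e]; trivial
    rw [this] at h0
    simp at h0

theorem TT_succ {X : Type*} [mX : MeasurableSpace X] {ν : Measure X} [IsProbabilityMeasure ν]
    {n : ℕ} {cyl : Finset (Fin n) → Set (Set X)} (h : Sys ν n cyl) (k j : ℕ) (hj : j + 1 ≤ k)
    (ih : TT ν cyl k j) : TT ν cyl k (j + 1) := by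
  classical
  intro A hA h0 δ hδ
  set N := Fintype.card (Finset (Fin n)) with hN
  -- thresholds
  have hδ3 : 0 < δ / 3 := ENNReal.div_pos hδ.ne' (by finiteness)
  obtain ⟨η, hη, hηδ⟩ : ∃ η : ℝ≥0∞, 0 < η ∧ ((N + 2 : ℕ) : ℝ≥0∞) * η ≤ δ / 3 :=
    ⟨δ / 3 / ((N + 2 : ℕ) : ℝ≥0∞), ENNReal.div_pos hδ3.ne' (by finiteness), ENNReal.mul_div_le⟩
  -- approximation
  have hC : ∀ I, ∃ C ∈ finDet (gens cyl I (j + 1)), I.card ≤ k → ν (A I \ C) ≤ η ∧ ν (C \ A I) ≤ η := by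
    intro I
    by_cases hI : I.card ≤ k
    · obtain ⟨C, hC, hC2⟩ := approx ν (gens cyl I (j + 1)) (h.mm_le I (j + 1)) (A I) (hA I hI) η hη
      exact ⟨C, hC, fun _ => hC2⟩
    · exact ⟨∅, ⟨@MeasurableSet.empty X (MeasurableSpace.generateFrom _), ∅, by simp, by simp⟩,
        fun h => absurd h hI⟩
  choose C hC hCA using hC
  obtain ⟨κ, hκ, hκ', c, hc, hdet⟩ := exists_coloring h j C hC
  have hmC : ∀ I, MeasurableSet (C I) := fun I => h.mm_le I (j + 1) _ (hC I).1
  have hmA : ∀ I, I.card ≤ k → MeasurableSet (A I) := fun I hI => h.mm_le I (j + 1) _ (hA I hI)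
  cases nonempty_fintype κ
  set P := Fintype.card (Finset (Fin n) → κ) with hP
  obtain ⟨δ', hδ', hδ'δ⟩ : ∃ η : ℝ≥0∞, 0 < η ∧ ((P : ℕ) : ℝ≥0∞) * η ≤ δ / 3 :=
    ⟨δ / 3 / ((P : ℕ) : ℝ≥0∞), ENNReal.div_pos hδ3.ne' (by finiteness), ENNReal.mul_div_le⟩
  obtain ⟨ε, hε, hεδ⟩ : ∃ ε : NNReal, 0 < ε ∧ (ε : ℝ≥0∞) < δ' := by
    obtain ⟨ε, h1, h2⟩ := ENNReal.lt_iff_exists_nnreal_btwn.1 hδ'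
    exact ⟨ε, by simpa using h1, h2⟩
  -- the good sets
  let res : Finset (Fin n) → (Finset (Fin n) → κ) → (Finset (Fin n) → κ) :=
    fun I p J => if J ⊆ I ∧ J.card ≤ j + 1 then p J else default
  have hres : ∀ I p q, res I p = res I q ↔ ∀ J, J ⊆ I → J.card ≤ j + 1 → p J = q J := by
    intro I p q
    constructor
    · intro he J h1 h2
      have := congrFun he J
      simpa [res, h1, h2] using this
    · intro he
      funext J
      by_cases hJ : J ⊆ I ∧ J.card ≤ j + 1
      · simp [res, hJ, he J hJ.1 hJ.2]
      · simp [res, hJ]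
  have hcellres : ∀ I p, cell c j (res I p) I = cell c j p I := by
    intro I p
    ext x
    simp only [mem_cell]
    constructor
    · intro hx J h1 h2
      simpa [res, h1, h2] using hx J h1 h2
    · intro hx J h1 h2
      simpa [res, h1, h2] using hx J h1 h2
  have hmemcell : ∀ I p x, x ∈ cell c j p I ↔ res I (fun J => c J x) = res I p := by
    intro I p x
    rw [mem_cell, hres]
  choose D hDm hD1 hD2 using fun (I : Finset (Fin n)) (q : Finset (Fin n) → κ) =>
    hahn_sub ν (mm cyl I j) (h.mm_le I j) ((N + 1 : ℕ) : NNReal) (cell c j q I \ A I) (cell c j q I)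
  choose S hSm hS1 hS2 using fun (I : Finset (Fin n)) (v : κ) =>
    hahn_sub ν (mm cyl I j) (h.mm_le I j) ε univ (c I ⁻¹' {v})
  have hnull : ∀ p : Finset (Fin n) → κ,
      ν ((⋂ J, ⋂ (_ : J.card ≤ j + 1), S J (p J)) ∩ ⋂ I, ⋂ (_ : I.card ≤ k), D I (res I p)) = 0 := by
    intro p
    refine zero2 h hc j k p (fun I => D I (res I p)) (fun I => S I (p I)) (fun I _ => hDm I _)
      ?_ ε hε (fun I => hSm I _) (fun I => hS1 I _)
    refine zero1 h hc j k p A (fun I => D I (res I p)) hA h0 (fun I _ => hDm I _) ?_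
    intro I _ T hT hTD
    have := hD1 I (res I p) T hT hTD
    rwa [hcellres] at this
  let E : (Finset (Fin n) → κ) → Finset (Fin n) → Set X := fun p I =>
    D I (res I p) ∩ if I.card ≤ j + 1 then S I (p I) else univ
  have hB : ∀ p, ∃ B : Finset (Fin n) → Set X, (∀ I, B I ∈ cyl I) ∧
      (∀ I, I.card ≤ k → ν (E p I \ B I) ≤ δ') ∧ ∀ x, ∃ I, I.card ≤ k ∧ x ∉ B I := by
    intro p
    refine ih (E p) ?_ ?_ δ' hδ'
    · intro I _
      refine MeasurableSet.inter (hDm I _) ?_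
      split_ifs
      · exact hSm I _
      · exact MeasurableSet.univ
    · refine measure_mono_null ?_ (hnull p)
      intro x hx
      refine ⟨?_, ?_⟩
      · simp only [mem_iInter]
        intro J hJ
        have := (hx J (hJ.trans hj)).2
        simpa [hJ] using this
      · simp only [mem_iInter]
        intro J hJ
        exact (hx J hJ).1
  choose B hBc hBE hBx using hB
  refine ⟨fun I => ⋂ p, ((cell c j p I)ᶜ ∪ B p I), ?_, ?_, ?_⟩
  · intro I
    refine IsSetAlgebra.iInter_mem (h.alg I) fun p => ?_
    exact (h.alg I).union_mem ((h.alg I).compl_mem (h.cell_mem hc j p I)) (hBc p I)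
  · intro I hI
    set As : Set X := {x | x ∈ D I (res I fun J => c J x)} with hAs
    have t1 : ν (A I \ C I) ≤ η := (hCA I hI).1
    have t2 : ν (C I \ As) ≤ ((N + 1 : ℕ) : ℝ≥0∞) * η := by
      let f : X → (Finset (Fin n) → κ) := fun x => res I fun J => c J x
      have hfib : ∀ q, f ⁻¹' {q} = ∅ ∨ f ⁻¹' {q} = cell c j q I := by
        intro q
        by_cases hq : ∃ x, f x = q
        · obtain ⟨x, rfl⟩ := hq
          right
          ext y
          rw [hcellres, hmemcell]
          rfl
        · left
          ext y
          simp only [mem_preimage, mem_singleton_iff, mem_empty_iff_false, iff_false]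
          exact fun hy => hq ⟨y, hy⟩
      have hfm : ∀ q, MeasurableSet (f ⁻¹' {q}) := by
        intro q
        rcases hfib q with e | e <;> rw [e]
        · exact MeasurableSet.empty
        · exact h.meas I _ (h.cell_mem hc j q I)
      have hone : ∀ q, ν ((C I \ As) ∩ f ⁻¹' {q}) ≤
          ((N + 1 : ℕ) : ℝ≥0∞) * (ν.restrict (C I \ A I)) (f ⁻¹' {q}) := by
        intro q
        rw [Measure.restrict_apply (hfm q)]
        by_cases hne : ((C I \ As) ∩ f ⁻¹' {q}).Nonempty
        · obtain ⟨x, hx, hxq⟩ := hne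
          have hcell : f ⁻¹' {q} = cell c j q I := by
            rcases hfib q with e | e
            · rw [e] at hxq; exact hxq.elim
            · exact e
          have hfx : f x = q := hxq
          have hsub : f ⁻¹' {q} ⊆ C I := by
            intro y hy
            have hy' : f y = f x := (show f y = q from hy).trans hfx.symm
            refine (hdet I y x fun J h1 h2 => ?_).2 hx.1
            exact (hres I _ _).1 hy' J h1 h2
          have := hD2 I q (D I q)ᶜ (hDm I q).compl le_rfl
          calc ν ((C I \ As) ∩ f ⁻¹' {q}) ≤ ν ((D I q)ᶜ ∩ cell c j q I) := by
                refine measure_mono ?_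
                rintro y ⟨⟨-, hy⟩, hyq⟩
                refine ⟨fun hyD => hy ?_, hcell ▸ hyq⟩
                have : f y = q := hyq
                rw [← this] at hyD
                exact hyD
            _ ≤ _ := this
            _ ≤ _ := by
                rw [ENNReal.coe_natCast]
                refine mul_le_mul_right (measure_mono ?_) _
                rintro y ⟨-, hy, hyA⟩
                rw [← hcell] at hy
                exact ⟨hy, hsub hy, hyA⟩
        · rw [not_nonempty_iff_eq_empty.1 hne]
          simp
      calc ν (C I \ As) ≤ ν (⋃ q ∈ (Finset.univ : Finset (Finset (Fin n) → κ)),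
              ((C I \ As) ∩ f ⁻¹' {q})) := by
            refine measure_mono fun x hx => ?_
            simp only [mem_iUnion]
            exact ⟨f x, Finset.mem_univ _, hx, rfl⟩
        _ ≤ ∑ q, ν ((C I \ As) ∩ f ⁻¹' {q}) := measure_biUnion_finset_le _ _
        _ ≤ ∑ q, ((N + 1 : ℕ) : ℝ≥0∞) * (ν.restrict (C I \ A I)) (f ⁻¹' {q}) :=
            Finset.sum_le_sum fun q _ => hone q
        _ = ((N + 1 : ℕ) : ℝ≥0∞) * ∑ q, (ν.restrict (C I \ A I)) (f ⁻¹' {q}) := by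
            rw [Finset.mul_sum]
        _ = ((N + 1 : ℕ) : ℝ≥0∞) * ν (C I \ A I) := by
            rw [sum_measure_preimage_singleton _ (fun q _ => hfm q)]
            simp
        _ ≤ _ := by
            gcongr
            exact (hCA I hI).2
    have t3 : ν (As \ ⋂ p, ((cell c j p I)ᶜ ∪ B p I)) ≤ (P : ℝ≥0∞) * (δ' + δ') := by
      calc ν (As \ ⋂ p, ((cell c j p I)ᶜ ∪ B p I))
          ≤ ν (⋃ p ∈ (Finset.univ : Finset (Finset (Fin n) → κ)),
            ((E p I \ B p I) ∪ (if I.card ≤ j + 1 then (S I (p I))ᶜ ∩ c I ⁻¹' {p I} else ∅))) := by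
            refine measure_mono ?_
            rintro x ⟨hx, hxB⟩
            simp only [mem_iInter, not_forall] at hxB
            obtain ⟨p, hp⟩ := hxB
            simp only [mem_union, mem_compl_iff, not_or, not_not] at hp
            obtain ⟨hp1, hp2⟩ := hp
            have hxD : x ∈ D I (res I p) := by
              have := hx
              rw [hAs, mem_ofPred_eq, (hmemcell I p x).1 hp1] at this
              exact this
            simp only [mem_iUnion]
            refine ⟨p, Finset.mem_univ _, ?_⟩
            by_cases hIj : I.card ≤ j + 1
            · by_cases hxS : x ∈ S I (p I)
              · left
                exact ⟨⟨hxD, by simpa [hIj] using hxS⟩, hp2⟩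
              · right
                simp only [hIj, if_true]
                exact ⟨hxS, mem_cell.1 hp1 I subset_rfl hIj⟩
            · left
              exact ⟨⟨hxD, by simp [hIj]⟩, hp2⟩
        _ ≤ ∑ p : (Finset (Fin n) → κ), ν ((E p I \ B p I) ∪
              (if I.card ≤ j + 1 then (S I (p I))ᶜ ∩ c I ⁻¹' {p I} else ∅)) :=
            measure_biUnion_finset_le _ _
        _ ≤ ∑ p : (Finset (Fin n) → κ), (δ' + δ') := by
            refine Finset.sum_le_sum fun p _ => (measure_union_le _ _).trans ?_
            refine add_le_add (hBE p I hI) ?_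
            split_ifs
            · refine (hS2 I (p I) _ (hSm I _).compl le_rfl).trans ?_
              calc (ε : ℝ≥0∞) * ν ((S I (p I))ᶜ ∩ univ) ≤ ε * 1 := by
                    gcongr
                    exact prob_le_one
                _ ≤ δ' := by rw [mul_one]; exact hεδ.le
            · simp
        _ = (P : ℝ≥0∞) * (δ' + δ') := by
            rw [Finset.sum_const, Finset.card_univ, nsmul_eq_mul]
    calc ν (A I \ ⋂ p, ((cell c j p I)ᶜ ∪ B p I))
        ≤ ν ((A I \ C I) ∪ ((C I \ As) ∪ (As \ ⋂ p, ((cell c j p I)ᶜ ∪ B p I)))) := by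
          refine measure_mono ?_
          rintro x ⟨hx, hxB⟩
          by_cases h1 : x ∈ C I
          · by_cases h2 : x ∈ As
            · exact Or.inr (Or.inr ⟨h2, hxB⟩)
            · exact Or.inr (Or.inl ⟨h1, h2⟩)
          · exact Or.inl ⟨hx, h1⟩
      _ ≤ η + (((N + 1 : ℕ) : ℝ≥0∞) * η + (P : ℝ≥0∞) * (δ' + δ')) :=
          (measure_union_le _ _).trans (add_le_add t1 ((measure_union_le _ _).trans
            (add_le_add t2 t3)))
      _ = ((N + 2 : ℕ) : ℝ≥0∞) * η + ((P : ℝ≥0∞) * δ' + (P : ℝ≥0∞) * δ') := by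
          push_cast; ring
      _ ≤ δ / 3 + (δ / 3 + δ / 3) := by gcongr
      _ = δ := by rw [← add_assoc, ENNReal.add_thirds]
  · intro x
    obtain ⟨I, hI, hx⟩ := hBx (fun J => c J x) x
    refine ⟨I, hI, fun hcon => ?_⟩
    have := mem_iInter.1 hcon (fun J => c J x)
    rcases this with h1 | h1
    · exact h1 (mem_cell.2 fun _ _ _ => rfl)
    · exact hx h1

theorem TT_all {X : Type*} [mX : MeasurableSpace X] {ν : Measure X} [IsProbabilityMeasure ν]
    {n : ℕ} {cyl : Finset (Fin n) → Set (Set X)} (h : Sys ν n cyl) (k : ℕ) :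
    ∀ j, j ≤ k → TT ν cyl k j := by
  intro j
  induction j with
  | zero => exact fun _ => TT_zero h k
  | succ j ih => exact fun hj => TT_succ h k j hj (ih (by omega))

theorem abstract_removal {X : Type*} [mX : MeasurableSpace X] {ν : Measure X}
    [IsProbabilityMeasure ν]
    {n : ℕ} {cyl : Finset (Fin n) → Set (Set X)} (h : Sys ν n cyl) (k : ℕ) (hk : k < n)
    (A : Finset (Fin n) → Set X)
    (hA : ∀ I : Finset (Fin n), I.card = k → MeasurableSet[MeasurableSpace.generateFrom (cyl I)] (A I))
    (δ : ℝ≥0∞) (hδ : 0 < δ)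
    (hB : ∀ B : Finset (Fin n) → Set X,
      (∀ I : Finset (Fin n), I.card = k → B I ∈ cyl I) →
      (∀ I : Finset (Fin n), I.card = k → ν (A I \ B I) < δ) →
      (⋂ (I : Finset (Fin n)) (_ : I.card = k), B I).Nonempty) :
    0 < ν (⋂ (I : Finset (Fin n)) (_ : I.card = k), A I) := by
  classical
  rw [pos_iff_ne_zero]
  intro h0
  obtain ⟨δ1, hδ1, hδ1δ⟩ := exists_between hδ
  set N := Fintype.card (Finset (Fin n)) with hN
  obtain ⟨η, hη, hηδ⟩ : ∃ η : ℝ≥0∞, 0 < η ∧ (N : ℝ≥0∞) * η ≤ δ1 :=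
    ⟨δ1 / (N : ℝ≥0∞), ENNReal.div_pos hδ1.ne' (by finiteness), ENNReal.mul_div_le⟩
  obtain ⟨B, hBc, hBA, hBx⟩ := TT_all h k k le_rfl (fun I => if I.card = k then A I else univ)
    (by
      intro I hI
      split_ifs with hIk
      · refine MeasurableSpace.generateFrom_mono ?_ _ (hA I hIk)
        intro s hs
        exact ⟨I, subset_rfl, hI, hs⟩
      · exact MeasurableSet.univ)
    (by
      refine measure_mono_null ?_ h0
      intro x hx
      simp only [mem_iInter]
      intro I hI
      have := hx I hI.le
      simpa [hI] using this) η hη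
  obtain ⟨x, hx⟩ := hB (fun I => ⋂ K, ⋂ (_ : K ⊆ I), B K) (by
      intro I _
      exact IsSetAlgebra.iInter_mem (h.alg I) fun K => IsSetAlgebra.iInter_prop_mem (h.alg I)
        fun hK => h.mono K I hK (hBc K)) (by
      intro I hI
      refine lt_of_le_of_lt ?_ hδ1δ
      calc ν (A I \ ⋂ K, ⋂ (_ : K ⊆ I), B K)
          ≤ ν (⋃ K ∈ Finset.univ.filter (fun K : Finset (Fin n) => K ⊆ I),
              ((if K.card = k then A K else univ) \ B K)) := by
            refine measure_mono ?_
            rintro y ⟨hy, hyB⟩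
            simp only [mem_iInter, not_forall] at hyB
            obtain ⟨K, hK, hyK⟩ := hyB
            simp only [mem_iUnion]
            refine ⟨K, by simpa using hK, ?_, hyK⟩
            split_ifs with hKk
            · have : K = I := Finset.eq_of_subset_of_card_le hK (by omega)
              rwa [this]
            · trivial
        _ ≤ ∑ K ∈ Finset.univ.filter (fun K : Finset (Fin n) => K ⊆ I),
              ν ((if K.card = k then A K else univ) \ B K) := measure_biUnion_finset_le _ _
        _ ≤ ∑ K ∈ Finset.univ.filter (fun K : Finset (Fin n) => K ⊆ I), η := by
            refine Finset.sum_le_sum fun K hK => hBA K ?_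
            rw [← hI]
            exact Finset.card_le_card (by simpa using hK)
        _ ≤ ∑ K : Finset (Fin n), η := Finset.sum_le_sum_of_subset (Finset.filter_subset _ _)
        _ = N * η := by simp [hN]
        _ ≤ δ1 := hηδ)
  obtain ⟨K, hK, hxK⟩ := hBx x
  obtain ⟨I, hKI, hI⟩ := Finset.exists_superset_card_eq hK (by simpa using hk.le)
  simp only [mem_iInter] at hx
  exact hxK (hx I hI K hKI)

theorem definable_substitute {L : FirstOrder.Language} {M : Type*} [L.Structure M]
    {α β : Type*} {s : Set (α → M)} (hs : (Set.univ : Set M).Definable L s) (g : α → β ⊕ M) :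
    (Set.univ : Set M).Definable L
      {x : β → M | (fun a => Sum.elim x id (g a)) ∈ s} := by
  rw [Set.definable_iff_exists_formula_sum] at hs ⊢
  obtain ⟨φ, rfl⟩ := hs
  refine ⟨φ.relabel (Sum.elim Sum.inl
    (fun a => Sum.elim (fun b => Sum.inr b) (fun m => Sum.inl ⟨m, Set.mem_univ m⟩) (g a))), ?_⟩
  ext x
  simp only [Set.mem_ofPred_eq, FirstOrder.Language.Formula.realize_relabel]
  apply iff_of_eq
  congr 1
  funext z
  rcases z with z | a
  · simp
  · rcases hg : g a with b | m <;> simp [hg]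

theorem measurable_proj (L : FirstOrder.Language) (M : Type*) [L.Structure M] (n : ℕ)
    (I : Finset (Fin n)) :
    @Measurable _ _ (defSigma L M (Fin n)) (defSigma L M ↥I) (proj M n I) := by
  letI := defSigma L M (Fin n)
  refine measurable_generateFrom ?_
  intro t ht
  exact MeasurableSpace.measurableSet_generateFrom
    (definable_substitute ht (fun i : ↥I => Sum.inl (i : Fin n)))

theorem measurable_glue (L : FirstOrder.Language) (M : Type*) [L.Structure M] (n : ℕ)
    (I : Finset (Fin n)) (y : ↥(Iᶜ) → M) :
    @Measurable _ _ (defSigma L M ↥I) (defSigma L M (Fin n)) (fun x => glue M n I x y) := by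
  letI := defSigma L M ↥I
  refine measurable_generateFrom ?_
  intro t ht
  have h := definable_substitute ht (fun i : Fin n => if h : i ∈ I then
    (Sum.inl (⟨i, h⟩ : ↥I) : ↥I ⊕ M) else Sum.inr (y ⟨i, Finset.mem_compl.mpr h⟩))
  refine MeasurableSpace.measurableSet_generateFrom ?_
  rw [Set.mem_ofPred_eq]
  convert h using 1
  ext x
  simp only [Set.mem_preimage, Set.mem_ofPred_eq]
  apply iff_of_eq
  congr 1
  funext i
  unfold glue
  split_ifs <;> simp

theorem sys_of_fubini (L : FirstOrder.Language) (M : Type*) [L.Structure M] (n : ℕ)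
    (ν : @Measure (Fin n → M) (defSigma L M (Fin n)))
    (hfub : FubiniCond L M n ν) :
    @Sys (Fin n → M) (defSigma L M (Fin n)) ν n (cylDef L M n) := by
  letI := defSigma L M (Fin n)
  refine @Sys.mk (Fin n → M) (defSigma L M (Fin n)) ν n (cylDef L M n) ?_ ?_ ?_ ?_ ?_
  · intro I
    refine ⟨⟨∅, Set.definable_empty, by simp⟩, ?_, ?_⟩
    · rintro s ⟨t, ht, rfl⟩
      exact ⟨tᶜ, ht.compl, rfl⟩
    · rintro s s' ⟨t, ht, rfl⟩ ⟨t', ht', rfl⟩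
      exact ⟨t ∪ t', ht.union ht', rfl⟩
  · rintro I J hIJ s ⟨t, ht, rfl⟩
    exact ⟨_, definable_substitute ht (fun i : ↥I => Sum.inl (⟨i, hIJ i.2⟩ : ↥J)), rfl⟩
  · rintro I s ⟨t, ht, rfl⟩
    exact MeasurableSpace.measurableSet_generateFrom
      (definable_substitute ht (fun i : ↥I => Sum.inl (i : Fin n)))
  · rintro s ⟨t, ht, rfl⟩
    rcases t.eq_empty_or_nonempty with rfl | ⟨a, ha⟩
    · left; rfl
    · right
      ext x
      simp only [Set.mem_preimage, Set.mem_univ, iff_true]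
      have : proj M n ∅ x = a := by
        funext i
        exact absurd i.2 (Finset.notMem_empty _)
      rwa [this]
  · intro I
    refine ⟨{φ | ∃ y : ↥(Iᶜ) → M, φ = fun x => glue M n I (proj M n I x) y}, ?_, ?_, ?_⟩
    · rintro φ ⟨y, rfl⟩ K s ⟨t, ht, rfl⟩
      refine ⟨_, definable_substitute ht (fun i : ↥K => if h : (i : Fin n) ∈ I then
        (Sum.inl (⟨i, Finset.mem_inter.mpr ⟨i.2, h⟩⟩ : ↥(K ∩ I)) : ↥(K ∩ I) ⊕ M)
        else Sum.inr (y ⟨i, Finset.mem_compl.mpr h⟩)), ?_⟩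
      ext x
      simp only [Set.mem_preimage, Set.mem_ofPred_eq]
      apply iff_of_eq
      congr 1
      funext i
      unfold proj glue
      split_ifs <;> simp
    · rintro φ ⟨y, rfl⟩ s ⟨t, ht, rfl⟩
      ext x
      simp only [Set.mem_preimage]
      apply iff_of_eq
      congr 1
      funext i
      simp [proj, glue]
    · rintro f hf ⟨C, hC⟩ hΦ
      have h1 := hfub I f hf ⟨C, Filter.Eventually.of_forall hC⟩
      refine h1.trans_le ?_
      letI := defSigma L M ↥(Iᶜ)
      refine integral_nonpos (fun y => ?_)
      have h2 := hΦ _ ⟨y, rfl⟩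
      refine le_of_eq_of_le ?_ h2
      letI := defSigma L M ↥I
      exact integral_map (measurable_proj L M n I).aemeasurable
        (hf.comp (measurable_glue L M n I y)).aestronglyMeasurable

/-- **Towsner's infinitary hypergraph removal lemma** (Theorem 2.3):
if there is `δ > 0` such that for all `B_I ∈ B⁰_{V,I}` (for `I` a `k`-subset of `V`) with
`ν^V(A_I ∖ B_I) < δ` the intersection `⋂_I B_I` is nonempty, then
`ν^V(⋂_I A_I) > 0`. -/
theorem hypergraph_removal
    (L : FirstOrder.Language) (M : Type*) [L.Structure M]
    [Countable (Σ l, L.Functions l)] [Countable (Σ l, L.Relations l)]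
    (hsat : Aleph1Saturated L M)
    (n : ℕ) (hn : 2 ≤ n)
    (ν : @Measure (Fin n → M) (defSigma L M (Fin n)))
    (hprob : ν Set.univ = 1)
    (hdef : DefinabilityCond L M n ν)
    (hfub : FubiniCond L M n ν)
    (k : ℕ) (hk : k < n)
    (A : Finset (Fin n) → Set (Fin n → M))
    (hA : ∀ I : Finset (Fin n), I.card = k → MeasurableSet[cylSigma L M n I] (A I))
    (δ : ℝ≥0∞) (hδ : 0 < δ)
    (hB : ∀ B : Finset (Fin n) → Set (Fin n → M),
      (∀ I : Finset (Fin n), I.card = k → B I ∈ cylDef L M n I) →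
      (∀ I : Finset (Fin n), I.card = k → ν (A I \ B I) < δ) →
      (⋂ (I : Finset (Fin n)) (_ : I.card = k), B I).Nonempty) :
    0 < ν (⋂ (I : Finset (Fin n)) (_ : I.card = k), A I) := by
  have h1 : @Sys (Fin n → M) (defSigma L M (Fin n)) ν n (cylDef L M n) :=
    sys_of_fubini L M n ν hfub
  have h2 : @IsProbabilityMeasure _ (defSigma L M (Fin n)) ν :=
    @IsProbabilityMeasure.mk _ (defSigma L M (Fin n)) ν hprob
  exact @abstract_removal _ (defSigma L M (Fin n)) ν h2 n (cylDef L M n) h1 k hk A hA δ hδ hB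

end MeasureAmalgamation
end

section
/- Let J = {1,…,n−1} and let 𝒥 be the set of (n−1)-element subsets of V. Suppose E ∈ B_V is such that: (a) ν^J(π_J(E)) > 0; (b) there is l ∈ ℕ such that for all I ∈ 𝒥 and ā ∈ M^I, the fibre π_I⁻¹(ā) ∩ E has at most l elements; (c) there is k > 0 such that for every F ∈ B⁰_V and every I ∈ 𝒥, ν^J(π_J(F ∩ E)) ≤ k·ν^I(π_I(F ∩ E)). Then ν^V({b̄ ∈ M^V : π_I(b̄) ∈ π_I(E) for all I ∈ 𝒥}) > 0. -/
open FirstOrder MeasureTheory Set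
open scoped ENNReal

namespace MeasureAmalgamation

variable (L : FirstOrder.Language) (M : Type*) [L.Structure M]

variable (n : ℕ)

/-- The index set `J = {1,…,n−1}`, i.e. all indices except the last one. -/
def Jset (n : ℕ) (hn : 2 ≤ n) : Finset (Fin n) := {(⟨n - 1, by omega⟩ : Fin n)}ᶜ

section Prelim
variable {Ω : Type*}

lemma count_set (G : MeasurableSpace Ω) (𝒢 : Set (Set Ω)) (s : Set Ω)
    (h : MeasurableSet[G ⊔ MeasurableSpace.generateFrom 𝒢] s) :
    ∃ 𝓓 ⊆ 𝒢, 𝓓.Countable ∧ MeasurableSet[G ⊔ MeasurableSpace.generateFrom 𝓓] s := by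
  have e : G ⊔ MeasurableSpace.generateFrom 𝒢
      = MeasurableSpace.generateFrom ({t | MeasurableSet[G] t} ∪ 𝒢) := by
    rw [← MeasurableSpace.generateFrom_sup_generateFrom, MeasurableSpace.generateFrom_measurableSet]
  rw [e] at h
  induction s, h using MeasurableSpace.generateFrom_induction with
  | hC t ht _ =>
    rcases ht with ht | ht
    · exact ⟨∅, by simp, by simp, (le_sup_left : G ≤ _) _ ht⟩
    · refine ⟨{t}, by simpa using ht, by simp, ?_⟩
      exact (le_sup_right : MeasurableSpace.generateFrom {t} ≤ G ⊔ MeasurableSpace.generateFrom {t}) _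
        (MeasurableSpace.measurableSet_generateFrom rfl)
  | empty => exact ⟨∅, by simp, by simp, @MeasurableSet.empty _ (_)⟩
  | compl t _ ih =>
    obtain ⟨D, h1, h2, h3⟩ := ih
    exact ⟨D, h1, h2, @MeasurableSet.compl _ _ _ h3⟩
  | iUnion f _ ih =>
    choose D h1 h2 h3 using ih
    refine ⟨⋃ i, D i, by simpa using h1, countable_iUnion h2, ?_⟩
    refine @MeasurableSet.iUnion _ _ _ _ _ fun i => ?_
    refine (sup_le_sup_left (MeasurableSpace.generateFrom_mono ?_) G) _ (h3 i)
    exact subset_iUnion D i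

lemma count_fun (G : MeasurableSpace Ω) (𝒢 : Set (Set Ω)) (f : Ω → ℝ)
    (h : Measurable[G ⊔ MeasurableSpace.generateFrom 𝒢] f) :
    ∃ 𝓓 ⊆ 𝒢, 𝓓.Countable ∧ Measurable[G ⊔ MeasurableSpace.generateFrom 𝓓] f := by
  have := fun q : ℚ => count_set G 𝒢 (f ⁻¹' Iio (q : ℝ)) (h measurableSet_Iio)
  choose D h1 h2 h3 using this
  refine ⟨⋃ i, D i, by simpa using h1, countable_iUnion h2, ?_⟩
  rw [BorelSpace.measurable_eq (α := ℝ), Real.borel_eq_generateFrom_Iio_rat]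
  refine @measurable_generateFrom _ _ (_) _ _ ?_
  intro t ht
  simp only [mem_iUnion, mem_singleton_iff] at ht
  obtain ⟨q, rfl⟩ := ht
  refine (sup_le_sup_left (MeasurableSpace.generateFrom_mono ?_) G) _ (h3 q)
  exact subset_iUnion D q

lemma condExp_atom {G H : MeasurableSpace Ω} {m0 : MeasurableSpace Ω} (ν : Measure Ω)
    [IsProbabilityMeasure ν] (hGH : G ≤ H) (hH : H ≤ m0) {C : Set Ω} (hC : MeasurableSet[H] C)
    (htr : ∀ s, MeasurableSet[H] s → ∃ s', MeasurableSet[G] s' ∧ s ∩ C = s' ∩ C)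
    {b : Ω → ℝ} (hb : Integrable b ν) :
    ∀ᵐ x ∂ν, x ∈ C → ν[C.indicator b|G] x = ν[b|H] x * ν[C.indicator (fun _ => (1 : ℝ))|G] x := by
  set g := ν[C.indicator (fun _ => (1 : ℝ))|G] with hg
  set p := ν[C.indicator b|G] with hp
  have hG : G ≤ m0 := hGH.trans hH
  have hC0 : MeasurableSet C := hH _ hC
  have hgb : ∀ᵐ x ∂ν, |g x| ≤ 1 := by
    have := ae_bdd_abs_condExp_of_ae_bdd_abs (m := G) (R := 1) (μ := ν) (f := C.indicator (fun _ => (1 : ℝ)))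
      (Filter.Eventually.of_forall fun x => by by_cases hx : x ∈ C <;> simp [hx])
    simpa using this
  have hgm : StronglyMeasurable[G] g := stronglyMeasurable_condExp
  have hpm : StronglyMeasurable[G] p := stronglyMeasurable_condExp
  have hgi : Integrable g ν := integrable_condExp
  have hpi : Integrable p ν := integrable_condExp
  have hmulb : ∀ q : Ω → ℝ, Integrable q ν → Integrable (g * q) ν := fun q hq =>
    hq.bdd_mul (c := 1) hgi.aestronglyMeasurable (by simpa using hgb)
  have h1 : C.indicator p =ᵐ[ν] ν[C.indicator (g * b)|H] := by
    refine ae_eq_condExp_of_forall_setIntegral_eq hH ((hmulb b hb).indicator hC0) ?_ ?_ ?_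
    · intro s _ _
      exact (hpi.indicator hC0).integrableOn
    · intro s hs _
      obtain ⟨s', hs', hss⟩ := htr s hs
      have hsw : ∀ F : Ω → ℝ, ∫ x in s, C.indicator F x ∂ν = ∫ x in s', C.indicator F x ∂ν := by
        intro F
        rw [setIntegral_indicator hC0, setIntegral_indicator hC0, hss]
      rw [hsw, hsw]
      have e1 : C.indicator p = C.indicator (fun _ => (1 : ℝ)) * p := by
        ext x; by_cases hx : x ∈ C <;> simp [hx]
      have e2 : C.indicator (g * b) = g * C.indicator b := by
        ext x; by_cases hx : x ∈ C <;> simp [hx]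
      have i1 : Integrable (C.indicator (fun _ => (1 : ℝ)) * p) ν := e1 ▸ hpi.indicator hC0
      have i2 : Integrable (g * C.indicator b) ν := hmulb _ (hb.indicator hC0)
      rw [e1, e2, ← setIntegral_condExp hG i1 hs', ← setIntegral_condExp hG i2 hs']
      refine integral_congr_ae (ae_restrict_of_ae ?_)
      have c1 := condExp_mul_of_stronglyMeasurable_right hpm i1
        ((integrable_const (1:ℝ)).indicator hC0)
      have c2 := condExp_mul_of_stronglyMeasurable_left hgm i2 (hb.indicator hC0)
      exact c1.trans c2.symm
    · exact (hpm.mono hGH |>.indicator hC).aestronglyMeasurable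
  have h2 : ν[C.indicator (g * b)|H] =ᵐ[ν] C.indicator (g * ν[b|H]) := by
    refine (condExp_indicator (hmulb b hb) hC).trans ?_
    have := condExp_mul_of_stronglyMeasurable_left (hgm.mono hGH) (hmulb b hb) hb
    filter_upwards [this] with x hx
    by_cases hxC : x ∈ C <;> simp [hxC]
    simpa using hx
  filter_upwards [h1.trans h2] with x hx hxC
  simp only [hxC, indicator_of_mem, Pi.mul_apply] at hx
  rw [hx, mul_comm]

end Prelim

section Prelim2
variable {Ω : Type*}

/-- atoms of the finite algebra generated by the first `k` sets of a sequence -/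
def atomSet (D : ℕ → Set Ω) (k : ℕ) (w : Finset ℕ) : Set Ω := {z | ∀ j < k, (z ∈ D j ↔ j ∈ w)}

/-- the finite algebra generated by the first `k` sets of a sequence -/
def finAlg (D : ℕ → Set Ω) (k : ℕ) : MeasurableSpace Ω :=
  MeasurableSpace.generateFrom (D '' Iio k)

lemma atomSet_meas (m : MeasurableSpace Ω) (D : ℕ → Set Ω) (k : ℕ) (w : Finset ℕ)
    (h : ∀ j < k, MeasurableSet[m] (D j)) : MeasurableSet[m] (atomSet D k w) := by
  have : atomSet D k w = ⋂ j, ⋂ (_ : j < k), {z | z ∈ D j ↔ j ∈ w} := by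
    ext z; simp [atomSet]
  rw [this]
  refine MeasurableSet.iInter fun j => MeasurableSet.iInter fun hj => ?_
  by_cases hw : j ∈ w
  · simpa [hw] using h j hj
  · have e : {z | z ∈ D j ↔ j ∈ w} = (D j)ᶜ := by ext z; simp [hw]
    rw [e]; exact (h j hj).compl

lemma atomSet_trace (G : MeasurableSpace Ω) (D : ℕ → Set Ω) (k : ℕ) (w : Finset ℕ) (s : Set Ω)
    (hs : MeasurableSet[G ⊔ finAlg D k] s) :
    ∃ s', MeasurableSet[G] s' ∧ s ∩ atomSet D k w = s' ∩ atomSet D k w := by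
  have e : G ⊔ finAlg D k
      = MeasurableSpace.generateFrom ({t | MeasurableSet[G] t} ∪ D '' Iio k) := by
    rw [← MeasurableSpace.generateFrom_sup_generateFrom, MeasurableSpace.generateFrom_measurableSet]
    rfl
  rw [e] at hs
  induction s, hs using MeasurableSpace.generateFrom_induction with
  | hC t ht _ =>
    rcases ht with ht | ⟨j, hj, rfl⟩
    · exact ⟨t, ht, rfl⟩
    · by_cases hw : j ∈ w
      · refine ⟨univ, MeasurableSet.univ, ?_⟩
        ext z
        simp only [mem_inter_iff, mem_univ, true_and, and_iff_right_iff_imp]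
        intro hz
        exact (hz j hj).2 hw
      · refine ⟨∅, MeasurableSet.empty, ?_⟩
        ext z
        simp only [mem_inter_iff, mem_empty_iff_false, false_and, iff_false, not_and]
        intro h1 hz
        exact hw ((hz j hj).1 h1)
  | empty => exact ⟨∅, MeasurableSet.empty, rfl⟩
  | compl t _ ih =>
    obtain ⟨s', h1, h2⟩ := ih
    refine ⟨s'ᶜ, h1.compl, ?_⟩
    ext z
    have := Set.ext_iff.1 h2 z
    simp only [mem_inter_iff, mem_compl_iff] at this ⊢
    tauto
  | iUnion f _ ih =>
    choose s' h1 h2 using ih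
    refine ⟨⋃ i, s' i, MeasurableSet.iUnion h1, ?_⟩
    rw [iUnion_inter, iUnion_inter]
    exact iUnion_congr h2

lemma mart_conv {G : MeasurableSpace Ω} {m0 : MeasurableSpace Ω} (ν : Measure Ω)
    [IsProbabilityMeasure ν] (hG : G ≤ m0) (D : ℕ → Set Ω) (hD : ∀ j, MeasurableSet (D j))
    {b : Ω → ℝ} (hb : Integrable b ν)
    (hbm : StronglyMeasurable[G ⊔ MeasurableSpace.generateFrom (range D)] b) :
    ∀ᵐ x ∂ν, Filter.Tendsto (fun k => ν[b|G ⊔ finAlg D k] x) Filter.atTop (nhds (b x)) := by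
  let F : Filtration ℕ m0 :=
    { seq := fun k => G ⊔ finAlg D k
      mono' := fun i j hij => sup_le_sup_left
        (MeasurableSpace.generateFrom_mono (image_mono (Iio_subset_Iio hij))) G
      le' := fun k => sup_le hG (MeasurableSpace.generateFrom_le (by
        rintro _ ⟨j, _, rfl⟩; exact hD j)) }
  refine hb.tendsto_ae_condExp (ℱ := F) (hbm.mono ?_)
  refine sup_le (le_iSup_of_le (f := fun k => F k) 0 le_sup_left)
    (MeasurableSpace.generateFrom_le ?_)
  rintro _ ⟨j, rfl⟩
  refine (le_iSup (fun k => F k) (j + 1)) _ ((le_sup_right : finAlg D (j+1) ≤ _) _ ?_)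
  exact MeasurableSpace.measurableSet_generateFrom ⟨j, by simp, rfl⟩

lemma condExp_ind_pos {G : MeasurableSpace Ω} {m0 : MeasurableSpace Ω} (ν : Measure Ω)
    [IsProbabilityMeasure ν] (hG : G ≤ m0) {C : Set Ω} (hC : MeasurableSet C) :
    ∀ᵐ x ∂ν, x ∈ C → 0 < ν[C.indicator (fun _ => (1 : ℝ))|G] x := by
  set g := ν[C.indicator (fun _ => (1 : ℝ))|G] with hg
  have hgm : StronglyMeasurable[G] g := stronglyMeasurable_condExp
  have hs : MeasurableSet[G] {x | g x ≤ 0} :=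
    @measurableSet_le _ _ _ _ _ G _ _ _ _ _ hgm.measurable measurable_const
  have h1 := setIntegral_condExp hG ((integrable_const (1:ℝ) (μ := ν)).indicator hC) hs
  have h2 : ∫ x in {x | g x ≤ 0}, g x ∂ν ≤ 0 :=
    setIntegral_nonpos (hG _ hs) (fun x hx => hx)
  rw [← hg, setIntegral_indicator hC] at h1
  rw [h1] at h2
  simp only [integral_const, smul_eq_mul, mul_one, measureReal_restrict_apply, MeasurableSet.univ,
    univ_inter] at h2
  have h3 : ν ({x | g x ≤ 0} ∩ C) = 0 := by
    have : ν.real ({x | g x ≤ 0} ∩ C) = 0 := le_antisymm h2 measureReal_nonneg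
    rwa [measureReal_eq_zero_iff] at this
  rw [ae_iff]
  convert h3 using 2
  ext x
  simp [and_comm]

end Prelim2

section Abstract
variable {Ω : Type*} {n : ℕ}

/-- the join of the σ-algebras indexed by `S` -/
def Fs (𝓑 : Finset (Fin n) → MeasurableSpace Ω) (S : Finset (Finset (Fin n))) :
    MeasurableSpace Ω := ⨆ K ∈ S, 𝓑 K

lemma Fs_le {𝓑 : Finset (Fin n) → MeasurableSpace Ω} {S : Finset (Finset (Fin n))}
    {m : MeasurableSpace Ω} (h : ∀ K ∈ S, 𝓑 K ≤ m) : Fs 𝓑 S ≤ m := iSup₂_le h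

lemma le_Fs (𝓑 : Finset (Fin n) → MeasurableSpace Ω) {S : Finset (Finset (Fin n))}
    {K} (h : K ∈ S) : 𝓑 K ≤ Fs 𝓑 S := le_iSup₂_of_le K h le_rfl

lemma Fs_mono (𝓑 : Finset (Fin n) → MeasurableSpace Ω) {S T : Finset (Finset (Fin n))}
    (h : S ⊆ T) : Fs 𝓑 S ≤ Fs 𝓑 T := Fs_le fun _ hK => le_Fs 𝓑 (h hK)

/-- members of `S` contained in `I` -/
def below (S : Finset (Finset (Fin n))) (I : Finset (Fin n)) : Finset (Finset (Fin n)) :=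
  S.filter (· ⊆ I)

lemma mem_below {S : Finset (Finset (Fin n))} {I K : Finset (Fin n)} :
    K ∈ below S I ↔ K ∈ S ∧ K ⊆ I := by simp [below]

/-- relative independence of a family of σ-algebras -/
def RelIndep {m0 : MeasurableSpace Ω} (ν : Measure Ω) (𝓑 : Finset (Fin n) → MeasurableSpace Ω) :
    Prop :=
  ∀ (I : Finset (Fin n)) (S : Finset (Finset (Fin n))),
    (∀ K ∈ S, ∀ K' ⊆ K, K' ∈ S) → ∀ f : Ω → ℝ, StronglyMeasurable[𝓑 I] f →
    (∃ B : ℝ, ∀ᵐ x ∂ν, |f x| ≤ B) → ν[f|Fs 𝓑 S] =ᵐ[ν] ν[f|Fs 𝓑 (below S I)]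

lemma integrable_of_bdd {m0 : MeasurableSpace Ω} {ν : Measure Ω} [IsProbabilityMeasure ν]
    {f : Ω → ℝ} (hf : AEStronglyMeasurable f ν) {B : ℝ} (hB : ∀ᵐ x ∂ν, |f x| ≤ B) :
    Integrable f ν :=
  Integrable.of_bound hf B (by simpa using hB)

/-- a.e. statements, transferred to the outer measure -/
lemma transfer {m0 : MeasurableSpace Ω} {ν : Measure Ω} {m : OuterMeasure Ω}
    {G : MeasurableSpace Ω} (hm : ∀ N, MeasurableSet[G] N → ν N = 0 → m N = 0)
    {P : Ω → Prop} (hP : ∀ᵐ x ∂ν, P x) (hPm : MeasurableSet[G] {x | P x}) : ∀ᵐ x ∂m, P x := by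
  rw [ae_iff] at hP ⊢
  exact hm _ (@MeasurableSet.compl _ _ G hPm) hP

lemma meas_eq_mul (m : MeasurableSpace Ω) {f g h : Ω → ℝ} (hf : Measurable f)
    (hg : Measurable g) (hh : Measurable h) : MeasurableSet {x | f x = g x * h x} :=
  measurableSet_eq_fun hf (hg.mul hh)

section step
variable {G GK BI : MeasurableSpace Ω} {m0 : MeasurableSpace Ω} (ν : Measure Ω)
  [IsProbabilityMeasure ν] {m : OuterMeasure Ω}

/-- For almost every `x`, the averages of `b` over small atoms around `x` converge to `b x`. -/
lemma local_avg (hm : ∀ N, MeasurableSet[BI] N → ν N = 0 → m N = 0)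
    (hBI : BI ≤ m0) (hG : G ≤ BI) (hGK : GK ≤ BI) (D : ℕ → Set Ω) (hD : ∀ j, MeasurableSet[BI] (D j))
    (hcond : ∀ C, MeasurableSet[MeasurableSpace.generateFrom (range D)] C →
      ν[C.indicator (fun _ => (1 : ℝ))|G] =ᵐ[ν] ν[C.indicator (fun _ => (1 : ℝ))|GK])
    {b : Ω → ℝ} (hb : Integrable b ν)
    (hbm : StronglyMeasurable[G ⊔ MeasurableSpace.generateFrom (range D)] b) :
    ∀ᵐ x ∂m, Filter.Tendsto (fun k => ν[b|G ⊔ finAlg D k] x) Filter.atTop (nhds (b x)) ∧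
      ∀ k w, x ∈ atomSet D k w →
        ν[(atomSet D k w).indicator b|G] x = ν[b|G ⊔ finAlg D k] x *
          ν[(atomSet D k w).indicator (fun _ => (1 : ℝ))|GK] x := by
  have hFle : ∀ k, G ⊔ finAlg D k ≤ BI := fun k => sup_le hG
    (MeasurableSpace.generateFrom_le (by rintro _ ⟨j, _, rfl⟩; exact hD j))
  have hRle : G ⊔ MeasurableSpace.generateFrom (range D) ≤ BI := sup_le hG
    (MeasurableSpace.generateFrom_le (by rintro _ ⟨j, rfl⟩; exact hD j))
  have hmeas : ∀ k, Measurable[BI] (ν[b|G ⊔ finAlg D k]) := fun k =>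
    (stronglyMeasurable_condExp.mono (hFle k)).measurable
  refine Filter.Eventually.and ?_ ?_
  · refine transfer hm (mart_conv ν (hG.trans hBI) D (fun j => hBI _ (hD j)) hb hbm) ?_
    exact @measurableSet_tendsto_fun _ _ _ BI _ _ _ _ _ _ _ _ _ hmeas _ (hbm.mono hRle).measurable
  · rw [ae_all_iff]; intro k
    rw [ae_all_iff]; intro w
    have hC : MeasurableSet[finAlg D k] (atomSet D k w) := atomSet_meas _ _ _ _ fun j hj =>
      MeasurableSpace.measurableSet_generateFrom ⟨j, hj, rfl⟩
    have hCr : MeasurableSet[MeasurableSpace.generateFrom (range D)] (atomSet D k w) :=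
      atomSet_meas _ _ _ _ fun j hj => MeasurableSpace.measurableSet_generateFrom ⟨j, rfl⟩
    have hCB : MeasurableSet[BI] (atomSet D k w) := atomSet_meas _ _ _ _ fun j hj => hD j
    refine transfer (G := BI) hm ?_ ?_
    · have h1 := condExp_atom ν (G := G) (H := G ⊔ finAlg D k) le_sup_left ((hFle k).trans hBI)
        ((le_sup_right : finAlg D k ≤ G ⊔ finAlg D k) _ hC) (atomSet_trace G D k w) hb
      filter_upwards [h1, hcond _ hCr] with x hx hx' hxC
      rw [hx hxC, hx']
    · have e : {x | x ∈ atomSet D k w → ν[(atomSet D k w).indicator b|G] x = ν[b|G ⊔ finAlg D k] x *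
          ν[(atomSet D k w).indicator (fun _ => (1 : ℝ))|GK] x} = (atomSet D k w)ᶜ ∪
          {x | ν[(atomSet D k w).indicator b|G] x = ν[b|G ⊔ finAlg D k] x *
          ν[(atomSet D k w).indicator (fun _ => (1 : ℝ))|GK] x} := by
        ext x; simp [imp_iff_not_or]
      rw [e]
      refine @MeasurableSet.union _ BI _ _ (@MeasurableSet.compl _ _ BI hCB) ?_
      exact meas_eq_mul BI ((stronglyMeasurable_condExp.mono hG).measurable) (hmeas k)
        ((stronglyMeasurable_condExp.mono hGK).measurable)

lemma local_pos (hm : ∀ N, MeasurableSet[BI] N → ν N = 0 → m N = 0)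
    (hBI : BI ≤ m0) (hGK : GK ≤ BI) {C : Set Ω} (hC : MeasurableSet[BI] C) :
    ∀ᵐ x ∂m, x ∈ C → 0 < ν[C.indicator (fun _ => (1 : ℝ))|GK] x := by
  refine transfer hm (condExp_ind_pos ν (hGK.trans hBI) (hBI _ hC)) ?_
  have e : {x | x ∈ C → 0 < ν[C.indicator (fun _ => (1 : ℝ))|GK] x} = Cᶜ ∪
      {x | 0 < ν[C.indicator (fun _ => (1 : ℝ))|GK] x} := by
    ext x; simp [imp_iff_not_or]
  rw [e]
  refine @MeasurableSet.union _ BI _ _ (@MeasurableSet.compl _ _ BI hC) ?_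
  exact @measurableSet_lt _ _ _ _ _ BI _ _ _ _ _ measurable_const
    ((stronglyMeasurable_condExp.mono hGK).measurable)

end step
end Abstract

section Main
variable {Ω : Type*} {n : ℕ}

lemma below_lower {S : Finset (Finset (Fin n))} (hS : ∀ K ∈ S, ∀ K' ⊆ K, K' ∈ S)
    (I : Finset (Fin n)) : ∀ K ∈ below S I, ∀ K' ⊆ K, K' ∈ below S I := by
  intro K hK K' hK'
  rw [mem_below] at hK ⊢
  exact ⟨hS K hK.1 K' hK', hK'.trans hK.2⟩

lemma below_below (S : Finset (Finset (Fin n))) {I K : Finset (Fin n)} (h : K ⊆ I) :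
    below (below S I) K = below S K := by
  ext T
  simp only [mem_below]
  exact ⟨fun ⟨⟨a, _⟩, c⟩ => ⟨a, c⟩, fun ⟨a, c⟩ => ⟨⟨a, c.trans h⟩, c⟩⟩

/-- abbreviation for the conditional density of `C` given `G` -/
noncomputable def cden {m0 : MeasurableSpace Ω} (ν : Measure Ω) (G : MeasurableSpace Ω)
    (C : Set Ω) : Ω → ℝ := ν[C.indicator (fun _ => (1 : ℝ))|G]

lemma ind_bdd (C : Set Ω) (x : Ω) : |C.indicator (fun _ => (1 : ℝ)) x| ≤ 1 := by
  by_cases hx : x ∈ C <;> simp [hx]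

section
variable {m0 : MeasurableSpace Ω} {ν : Measure Ω} [IsProbabilityMeasure ν]
  {𝓑 : Finset (Fin n) → MeasurableSpace Ω} (h𝓑 : ∀ I, 𝓑 I ≤ m0) (hmono : Monotone 𝓑)
  (hri : RelIndep ν 𝓑)
include h𝓑 hmono hri

lemma step_in {S' : Finset (Finset (Fin n))} (hS' : ∀ K ∈ S', ∀ K' ⊆ K, K' ∈ S')
    {K I : Finset (Fin n)} (hKI : K ⊆ I) {C D' : Set Ω} (hC : MeasurableSet[𝓑 K] C)
    (hD' : MeasurableSet[Fs 𝓑 S'] D') {b : Ω → ℝ} (hb : StronglyMeasurable[𝓑 I] b) {B : ℝ}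
    (hB : ∀ᵐ x ∂ν, |b x| ≤ B) :
    ∫ x in D' ∩ C, b x ∂ν = ∫ x in D', ν[C.indicator b|Fs 𝓑 (below S' I)] x ∂ν := by
  have hC0 : MeasurableSet[m0] C := h𝓑 _ _ hC
  have hbi : Integrable b ν :=
    integrable_of_bdd ((hb.mono (h𝓑 I)).aestronglyMeasurable) hB
  have hle : Fs 𝓑 S' ≤ m0 := Fs_le fun K _ => h𝓑 K
  rw [← setIntegral_indicator hC0, ← setIntegral_condExp hle (hbi.indicator hC0) hD']
  refine integral_congr_ae (ae_restrict_of_ae ?_)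
  refine hri I S' hS' _ (hb.indicator (hmono hKI _ hC)) ⟨B, ?_⟩
  filter_upwards [hB] with x hx
  by_cases hxC : x ∈ C
  · simpa [hxC] using hx
  · simpa [hxC] using (abs_nonneg _).trans hx

lemma step_out {S' : Finset (Finset (Fin n))} (hS' : ∀ K ∈ S', ∀ K' ⊆ K, K' ∈ S')
    {K : Finset (Fin n)} {C D' : Set Ω} (hC : MeasurableSet[𝓑 K] C)
    (hD' : MeasurableSet[Fs 𝓑 S'] D') {b : Ω → ℝ} (hb : StronglyMeasurable[Fs 𝓑 S'] b) {B : ℝ}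
    (hB : ∀ᵐ x ∂ν, |b x| ≤ B) (c : ℝ) :
    ∫ x in D', (c * b x - B * |cden ν (Fs 𝓑 (below S' K)) C x - c|) ∂ν
      ≤ ∫ x in D' ∩ C, b x ∂ν := by
  have hC0 : MeasurableSet[m0] C := h𝓑 _ _ hC
  have hle : Fs 𝓑 S' ≤ m0 := Fs_le fun K _ => h𝓑 K
  have hbi : Integrable b ν :=
    integrable_of_bdd ((hb.mono hle).aestronglyMeasurable) hB
  have hgi : Integrable (cden ν (Fs 𝓑 (below S' K)) C) ν := integrable_condExp
  have hcd := hri K S' hS' (C.indicator (fun _ => (1 : ℝ)))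
    ((stronglyMeasurable_const).indicator hC) ⟨1, Filter.Eventually.of_forall (ind_bdd C)⟩
  have e : C.indicator b = b * C.indicator (fun _ => (1 : ℝ)) := by
    ext x; by_cases hx : x ∈ C <;> simp [hx]
  have hi : Integrable (b * C.indicator (fun _ => (1 : ℝ))) ν := e ▸ hbi.indicator hC0
  have hpo := condExp_mul_of_stronglyMeasurable_left hb hi
    ((integrable_const (1 : ℝ)).indicator hC0)
  rw [← setIntegral_indicator hC0, e, ← setIntegral_condExp hle hi hD']
  refine setIntegral_mono_ae ?_ integrable_condExp.integrableOn ?_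
  · exact ((hbi.const_mul c).sub (((hgi.sub (integrable_const c)).abs).const_mul B)).integrableOn
  · filter_upwards [hpo, hcd, hB] with x h1 h2 h3
    rw [h1, Pi.mul_apply, h2]
    change c * b x - B * |cden ν (Fs 𝓑 (below S' K)) C x - c| ≤
      b x * cden ν (Fs 𝓑 (below S' K)) C x
    set g := cden ν (Fs 𝓑 (below S' K)) C x
    have h4 : -(b x * (g - c)) ≤ B * |g - c| := by
      refine (neg_le_abs _).trans ?_
      rw [abs_mul]
      exact mul_le_mul_of_nonneg_right h3 (abs_nonneg _)
    linarith

end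

/-- the updated family of functions -/
noncomputable def newb {m0 : MeasurableSpace Ω} (ν : Measure Ω) (𝓑 : Finset (Fin n) → MeasurableSpace Ω)
    (S' : Finset (Finset (Fin n))) (K I0 : Finset (Fin n)) (C : Set Ω)
    (b : Finset (Fin n) → Ω → ℝ) (c B' : ℝ) (I : Finset (Fin n)) (x : Ω) : ℝ :=
  open Classical in
  if K ⊆ I then ν[C.indicator (b I)|Fs 𝓑 (below S' I)] x -
    (if I = I0 then B' * |cden ν (Fs 𝓑 (below S' K)) C x - c| else 0)
  else c * b I x

lemma newb_sum {m0 : MeasurableSpace Ω} {ν : Measure Ω}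
    {𝓑 : Finset (Fin n) → MeasurableSpace Ω} (𝒥 : Finset (Finset (Fin n))) (S' : Finset (Finset (Fin n)))
    (K I0 : Finset (Fin n)) (hI0 : I0 ∈ 𝒥) (hKI0 : K ⊆ I0) (C : Set Ω)
    (b : Finset (Fin n) → Ω → ℝ) (c B' : ℝ) (x : Ω) :
    ∑ I ∈ 𝒥, newb ν 𝓑 S' K I0 C b c B' I x =
      (∑ I ∈ 𝒥, if K ⊆ I then ν[C.indicator (b I)|Fs 𝓑 (below S' I)] x else c * b I x) -
        B' * |cden ν (Fs 𝓑 (below S' K)) C x - c| := by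
  classical
  have : ∀ I, newb ν 𝓑 S' K I0 C b c B' I x =
      (if K ⊆ I then ν[C.indicator (b I)|Fs 𝓑 (below S' I)] x else c * b I x) -
      (if I = I0 then B' * |cden ν (Fs 𝓑 (below S' K)) C x - c| else 0) := by
    intro I
    unfold newb
    by_cases h : K ⊆ I
    · simp [h]
    · have : I ≠ I0 := fun h' => h (h' ▸ hKI0)
      simp [h, this]
  simp only [this, Finset.sum_sub_distrib, Finset.sum_ite_eq', hI0, if_true]

section
variable {m0 : MeasurableSpace Ω} {ν : Measure Ω} [IsProbabilityMeasure ν]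
  {𝓑 : Finset (Fin n) → MeasurableSpace Ω} (h𝓑 : ∀ I, 𝓑 I ≤ m0) (hmono : Monotone 𝓑)
  (hri : RelIndep ν 𝓑)
include h𝓑 hmono hri

lemma step_int {S' : Finset (Finset (Fin n))} (hS' : ∀ K ∈ S', ∀ K' ⊆ K, K' ∈ S')
    (𝒥 : Finset (Finset (Fin n))) {K I0 : Finset (Fin n)} (hI0 : I0 ∈ 𝒥) (hKI0 : K ⊆ I0)
    {C D' : Set Ω} (hC : MeasurableSet[𝓑 K] C)
    (hD' : MeasurableSet[Fs 𝓑 S'] D') {b : Finset (Fin n) → Ω → ℝ}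
    (hb1 : ∀ I ∈ 𝒥, StronglyMeasurable[𝓑 I] (b I))
    (hb2 : ∀ I ∈ 𝒥, ¬ K ⊆ I → StronglyMeasurable[Fs 𝓑 S'] (b I)) {B : ℝ} (hB0 : 0 ≤ B)
    (hB : ∀ I ∈ 𝒥, ∀ᵐ x ∂ν, |b I x| ≤ B) (c : ℝ) :
    ∫ x in D', ∑ I ∈ 𝒥, newb ν 𝓑 S' K I0 C b c (𝒥.card * B) I x ∂ν
      ≤ ∫ x in D' ∩ C, ∑ I ∈ 𝒥, b I x ∂ν := by
  classical
  have hbi : ∀ I ∈ 𝒥, Integrable (b I) ν := fun I hI =>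
    integrable_of_bdd (((hb1 I hI).mono (h𝓑 I)).aestronglyMeasurable) (hB I hI)
  have hgi : Integrable (cden ν (Fs 𝓑 (below S' K)) C) ν := integrable_condExp
  have hai : Integrable (fun x => |cden ν (Fs 𝓑 (below S' K)) C x - c|) ν :=
    (hgi.sub (integrable_const c)).abs
  let β : Finset (Fin n) → Ω → ℝ := fun I x =>
    if K ⊆ I then ν[C.indicator (b I)|Fs 𝓑 (below S' I)] x
    else c * b I x - B * |cden ν (Fs 𝓑 (below S' K)) C x - c|
  have hβi : ∀ I ∈ 𝒥, Integrable (β I) ν := by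
    intro I hI
    by_cases h : K ⊆ I
    · simp only [β, h, if_true]; exact integrable_condExp
    · simp only [β, h, if_false]; exact ((hbi I hI).const_mul c).sub (hai.const_mul B)
  have hβ'i : ∀ I ∈ 𝒥, Integrable (fun x => if K ⊆ I then
      ν[C.indicator (b I)|Fs 𝓑 (below S' I)] x else c * b I x) ν := by
    intro I hI
    by_cases h : K ⊆ I
    · simp only [h, if_true]; exact integrable_condExp
    · simp only [h, if_false]; exact ((hbi I hI).const_mul c)
  rw [integral_finsetSum 𝒥 (fun I hI => (hbi I hI).integrableOn)]
  calc _ ≤ ∫ x in D', ∑ I ∈ 𝒥, β I x ∂ν := by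
        refine setIntegral_mono ?_ (integrable_finsetSum _ hβi).integrableOn ?_
        · simp only [newb_sum 𝒥 S' K I0 hI0 hKI0]
          exact ((integrable_finsetSum _ hβ'i).sub (hai.const_mul _)).integrableOn
        · intro x
          simp only [newb_sum 𝒥 S' K I0 hI0 hKI0]
          rw [mul_assoc, ← nsmul_eq_mul, ← Finset.sum_const, ← Finset.sum_sub_distrib]
          refine Finset.sum_le_sum fun I hI => ?_
          have : 0 ≤ B * |cden ν (Fs 𝓑 (below S' K)) C x - c| := by positivity
          by_cases h : K ⊆ I
          · simp only [β, h, if_true]; linarith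
          · simp only [β, h, if_false]; linarith
    _ = ∑ I ∈ 𝒥, ∫ x in D', β I x ∂ν :=
        integral_finsetSum 𝒥 (fun I hI => (hβi I hI).integrableOn)
    _ ≤ _ := by
        refine Finset.sum_le_sum fun I hI => ?_
        by_cases h : K ⊆ I
        · simp only [β, h, if_true]
          exact (step_in h𝓑 hmono hri hS' h hC hD' (hb1 I hI) (hB I hI)).ge
        · simp only [β, h, if_false]
          exact step_out h𝓑 hmono hri hS' hC hD' (hb2 I hI h) (hB I hI) c
end
end Main

section Lin
variable {Ω : Type*} {n : ℕ}
variable {m0 : MeasurableSpace Ω} {ν : Measure Ω} [IsProbabilityMeasure ν]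
  {𝓑 : Finset (Fin n) → MeasurableSpace Ω} 

/-- The conclusion of the main abstract lemma for a lower family `S`. -/
def LinConcl (ν : Measure Ω) (𝓑 : Finset (Fin n) → MeasurableSpace Ω) (m : OuterMeasure Ω)
    (𝒥 : Finset (Finset (Fin n))) (S : Finset (Finset (Fin n)))
    (A : Finset (Fin n) → Set Ω) (b : Finset (Fin n) → Ω → ℝ) : Prop :=
  ∀ᵐ x ∂m, (∀ K ∈ S, x ∈ A K) → 0 < ∑ I ∈ 𝒥, b I x →
    ∃ C : Finset (Fin n) → Set Ω, (∀ K ∈ S, MeasurableSet[𝓑 K] (C K) ∧ C K ⊆ A K) ∧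
      0 < ∫ x in ⋂ K ∈ S, C K, ∑ I ∈ 𝒥, b I x ∂ν

lemma exists_seq (h𝓑 : ∀ I, 𝓑 I ≤ m0) (𝒥 S' : Finset (Finset (Fin n))) (K : Finset (Fin n))
    (b : Finset (Fin n) → Ω → ℝ)
    (hb : ∀ I ∈ 𝒥, K ⊆ I → StronglyMeasurable[Fs 𝓑 (below S' I) ⊔ 𝓑 K] (b I))
    (A : Set Ω) (hA : MeasurableSet[𝓑 K] A) :
    ∃ D : ℕ → Set Ω, D 0 = A ∧ (∀ j, MeasurableSet[𝓑 K] (D j)) ∧ ∀ I ∈ 𝒥, K ⊆ I →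
      StronglyMeasurable[Fs 𝓑 (below S' I) ⊔ MeasurableSpace.generateFrom (range D)] (b I) := by
  have : ∀ I, ∃ 𝓓 ⊆ {t | MeasurableSet[𝓑 K] t}, 𝓓.Countable ∧ (I ∈ 𝒥 → K ⊆ I →
      Measurable[Fs 𝓑 (below S' I) ⊔ MeasurableSpace.generateFrom 𝓓] (b I)) := by
    intro I
    by_cases h : I ∈ 𝒥 ∧ K ⊆ I
    · obtain ⟨𝓓, h1, h2, h3⟩ := count_fun (Fs 𝓑 (below S' I)) {t | MeasurableSet[𝓑 K] t} (b I)
        (by rw [@MeasurableSpace.generateFrom_measurableSet _ (𝓑 K)]; exact (hb I h.1 h.2).measurable)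
      exact ⟨𝓓, h1, h2, fun _ _ => h3⟩
    · exact ⟨∅, by simp, by simp, fun h1 h2 => absurd ⟨h1, h2⟩ h⟩
  choose 𝓓 h1 h2 h3 using this
  have hc : (insert A (⋃ I, 𝓓 I)).Countable := (countable_iUnion h2).insert A
  obtain ⟨D, hD⟩ := hc.exists_eq_range ⟨A, mem_insert _ _⟩
  have hsub : insert A (⋃ I, 𝓓 I) ⊆ {t | MeasurableSet[𝓑 K] t} :=
    insert_subset hA (iUnion_subset h1)
  have hr : range (fun j : ℕ => if j = 0 then A else D (j - 1)) = insert A (⋃ I, 𝓓 I) := by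
    apply Subset.antisymm
    · rintro _ ⟨j, rfl⟩
      by_cases hj : j = 0
      · simp [hj]
      · simp only [hj, if_false]; rw [hD]; exact ⟨_, rfl⟩
    · intro t ht
      rw [hD] at ht
      obtain ⟨j, rfl⟩ := ht
      exact ⟨j + 1, by simp⟩
  refine ⟨fun j => if j = 0 then A else D (j - 1), by simp, ?_, ?_⟩
  · intro j
    exact hsub (hr ▸ ⟨j, rfl⟩)
  · intro I hI hKI
    rw [hr]
    refine Measurable.stronglyMeasurable ?_
    exact (h3 I hI hKI).mono (sup_le_sup_left (MeasurableSpace.generateFrom_mono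
      ((subset_iUnion 𝓓 I).trans (subset_insert _ _))) _) le_rfl

variable  (h𝓑 : ∀ I, 𝓑 I ≤ m0) (hmono : Monotone 𝓑) (hri : RelIndep ν 𝓑)
include h𝓑 hmono hri

lemma newb_meas {𝒥 S' : Finset (Finset (Fin n))} {K I0 : Finset (Fin n)} (hKI0 : K ⊆ I0) (C : Set Ω)
    (b : Finset (Fin n) → Ω → ℝ)
    (hb : ∀ I ∈ 𝒥, ¬ K ⊆ I → StronglyMeasurable[Fs 𝓑 (below S' I)] (b I)) (c B' : ℝ)
    (I : Finset (Fin n)) (hI : I ∈ 𝒥) :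
    StronglyMeasurable[Fs 𝓑 (below S' I)] (newb ν 𝓑 S' K I0 C b c B' I) := by
  unfold newb
  by_cases h : K ⊆ I
  · simp only [h, if_true]
    refine StronglyMeasurable.sub stronglyMeasurable_condExp ?_
    by_cases h' : I = I0
    · subst h'
      simp only [if_true]
      have h1 : StronglyMeasurable[Fs 𝓑 (below S' I)] (cden ν (Fs 𝓑 (below S' K)) C) := by
        refine StronglyMeasurable.mono (stronglyMeasurable_condExp (m := Fs 𝓑 (below S' K))) ?_
        refine Fs_mono 𝓑 ?_
        intro T hT
        rw [mem_below] at hT ⊢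
        exact ⟨hT.1, hT.2.trans h⟩
      have h2 : StronglyMeasurable[Fs 𝓑 (below S' I)]
          (fun x => cden ν (Fs 𝓑 (below S' K)) C x - c) := h1.sub stronglyMeasurable_const
      exact StronglyMeasurable.const_mul (StronglyMeasurable.norm h2) B'
    · simp only [h', if_false]; exact stronglyMeasurable_const
  · simp only [h, if_false]
    exact (hb I hI h).const_mul c

lemma newb_bdd {𝒥 S' : Finset (Finset (Fin n))} {K I0 : Finset (Fin n)} {C : Set Ω}
    (b : Finset (Fin n) → Ω → ℝ) {B : ℝ} (hB0 : 0 ≤ B)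
    (hB : ∀ I ∈ 𝒥, ∀ᵐ x ∂ν, |b I x| ≤ B) (c : ℝ) {B' : ℝ} (hB' : 0 ≤ B')
    (I : Finset (Fin n)) (hI : I ∈ 𝒥) :
    ∀ᵐ x ∂ν, |newb ν 𝓑 S' K I0 C b c B' I x| ≤ B + B' * (1 + |c|) + |c| * B := by
  have h1 : ∀ᵐ x ∂ν, |ν[C.indicator (b I)|Fs 𝓑 (below S' I)] x| ≤ B := by
    have := ae_bdd_abs_condExp_of_ae_bdd_abs (m := Fs 𝓑 (below S' I)) (R := B) (μ := ν)
      (f := C.indicator (b I)) (by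
        filter_upwards [hB I hI] with x hx
        by_cases hxC : x ∈ C
        · simpa [hxC] using hx
        · simpa [hxC] using hB0)
    simpa using this
  have h2 : ∀ᵐ x ∂ν, |cden ν (Fs 𝓑 (below S' K)) C x| ≤ 1 := by
    have := ae_bdd_abs_condExp_of_ae_bdd_abs (m := Fs 𝓑 (below S' K)) (R := 1) (μ := ν)
      (f := C.indicator (fun _ => (1 : ℝ)))
      (Filter.Eventually.of_forall fun x => by simpa using ind_bdd C x)
    simpa [cden] using this
  filter_upwards [h1, h2, hB I hI] with x h1 h2 h3
  have hc := abs_nonneg c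
  have p1 : 0 ≤ B' * (1 + |c|) := by positivity
  have p2 : 0 ≤ |c| * B := by positivity
  unfold newb
  by_cases h : K ⊆ I
  · simp only [h, if_true]
    refine (abs_sub _ _).trans ?_
    have : |(if I = I0 then B' * |cden ν (Fs 𝓑 (below S' K)) C x - c| else 0)| ≤
        B' * (1 + |c|) := by
      split_ifs
      · rw [abs_mul, abs_abs, abs_of_nonneg hB']
        refine mul_le_mul_of_nonneg_left ?_ hB'
        exact (abs_sub _ _).trans (by linarith)
      · simpa using p1
    linarith
  · simp only [h, if_false, abs_mul]
    have : |c| * |b I x| ≤ |c| * B := mul_le_mul_of_nonneg_left h3 hc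
    linarith

lemma Lin_step (m : OuterMeasure Ω) (𝒥 : Finset (Finset (Fin n)))
    (hm : ∀ I ∈ 𝒥, ∀ N, MeasurableSet[𝓑 I] N → ν N = 0 → m N = 0)
    {S : Finset (Finset (Fin n))} (hS : ∀ K ∈ S, ∀ K' ⊆ K, K' ∈ S)
    {K I0 : Finset (Fin n)} (hK : K ∈ S) (hKmax : ∀ K' ∈ S, K ⊆ K' → K' = K)
    (hI0 : I0 ∈ 𝒥) (hKI0 : K ⊆ I0)
    (A : Finset (Fin n) → Set Ω) (hA : ∀ K ∈ S, MeasurableSet[𝓑 K] (A K))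
    (b : Finset (Fin n) → Ω → ℝ) (hb : ∀ I ∈ 𝒥, StronglyMeasurable[Fs 𝓑 (below S I)] (b I))
    {B : ℝ} (hB0 : 0 ≤ B) (hB : ∀ I ∈ 𝒥, ∀ᵐ x ∂ν, |b I x| ≤ B)
    (IH : ∀ b' : Finset (Fin n) → Ω → ℝ,
      (∀ I ∈ 𝒥, StronglyMeasurable[Fs 𝓑 (below (S.erase K) I)] (b' I)) →
      (∃ B' : ℝ, 0 ≤ B' ∧ ∀ I ∈ 𝒥, ∀ᵐ x ∂ν, |b' I x| ≤ B') →
      LinConcl ν 𝓑 m 𝒥 (S.erase K) A b') :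
    LinConcl ν 𝓑 m 𝒥 S A b := by
  classical
  set S' := S.erase K with hS'def
  have hS' : ∀ K ∈ S', ∀ K' ⊆ K, K' ∈ S' := by
    intro T hT T' hT'
    rw [hS'def, Finset.mem_erase] at hT ⊢
    refine ⟨?_, hS T hT.2 T' hT'⟩
    rintro rfl
    exact hT.1 (hKmax T hT.2 hT')
  have hbelow : ∀ I, below S' I ⊆ below S I := by
    intro I T hT; rw [mem_below] at hT ⊢; exact ⟨Finset.mem_of_mem_erase hT.1, hT.2⟩
  have hFI : ∀ I, Fs 𝓑 (below S' I) ≤ 𝓑 I := fun I => Fs_le fun T hT => hmono (mem_below.1 hT).2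
  have hFSI : ∀ I, Fs 𝓑 (below S I) ≤ 𝓑 I := fun I => Fs_le fun T hT => hmono (mem_below.1 hT).2
  have hbin : ∀ I ∈ 𝒥, K ⊆ I → StronglyMeasurable[Fs 𝓑 (below S' I) ⊔ 𝓑 K] (b I) := by
    intro I hI hKI
    refine (hb I hI).mono (Fs_le fun T hT => ?_)
    by_cases h : T = K
    · subst h; exact le_sup_right
    · refine le_trans (le_Fs 𝓑 ?_) le_sup_left
      rw [mem_below] at hT ⊢
      exact ⟨Finset.mem_erase.2 ⟨h, hT.1⟩, hT.2⟩
  have hbout : ∀ I ∈ 𝒥, ¬ K ⊆ I → StronglyMeasurable[Fs 𝓑 (below S' I)] (b I) := by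
    intro I hI hKI
    refine (hb I hI).mono (Fs_mono 𝓑 ?_)
    intro T hT
    rw [mem_below] at hT ⊢
    exact ⟨Finset.mem_erase.2 ⟨fun h => hKI (h ▸ hT.2), hT.1⟩, hT.2⟩
  obtain ⟨D, hD0, hDm, hDb⟩ := exists_seq h𝓑 𝒥 S' K b hbin (A K) (hA K hK)
  have hbi : ∀ I ∈ 𝒥, Integrable (b I) ν := fun I hI =>
    integrable_of_bdd (((hb I hI).mono ((hFSI I).trans (h𝓑 I))).aestronglyMeasurable) (hB I hI)
  have hat : ∀ k w, MeasurableSet[𝓑 K] (atomSet D k w) := fun k w =>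
    atomSet_meas _ _ _ _ fun j _ => hDm j
  have hKbelow : ∀ I, K ⊆ I → Fs 𝓑 (below S' K) ≤ 𝓑 I := fun I h => (hFI K).trans (hmono h)
  have H1 : ∀ᵐ x ∂m, ∀ I, I ∈ 𝒥 → K ⊆ I →
      (Filter.Tendsto (fun k => ν[b I|Fs 𝓑 (below S' I) ⊔ finAlg D k] x) Filter.atTop
        (nhds (b I x)) ∧
      ∀ k w, x ∈ atomSet D k w →
        ν[(atomSet D k w).indicator (b I)|Fs 𝓑 (below S' I)] x =
          ν[b I|Fs 𝓑 (below S' I) ⊔ finAlg D k] x * cden ν (Fs 𝓑 (below S' K)) (atomSet D k w) x) := by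
    rw [ae_all_iff]; intro I
    by_cases hI : I ∈ 𝒥
    · by_cases hKI : K ⊆ I
      · have := local_avg ν (hm I hI) (h𝓑 I) (hFI I) (hKbelow I hKI) D
          (fun j => hmono hKI _ (hDm j)) ?_ (hbi I hI) (hDb I hI hKI)
        · filter_upwards [this] with x hx _ _ using hx
        · intro C hC
          have hCK : MeasurableSet[𝓑 K] C :=
            (MeasurableSpace.generateFrom_le (by rintro _ ⟨j, rfl⟩; exact hDm j)) _ hC
          have := hri K (below S' I) (below_lower hS' I) (C.indicator (fun _ => (1 : ℝ)))
            ((stronglyMeasurable_const).indicator hCK)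
            ⟨1, Filter.Eventually.of_forall (ind_bdd C)⟩
          rwa [below_below S' hKI] at this
      · exact Filter.Eventually.of_forall fun x _ h => absurd h hKI
    · exact Filter.Eventually.of_forall fun x h => absurd h hI
  have H2 : ∀ᵐ x ∂m, ∀ k w, x ∈ atomSet D k w →
      0 < cden ν (Fs 𝓑 (below S' K)) (atomSet D k w) x := by
    rw [ae_all_iff]; intro k
    rw [ae_all_iff]; intro w
    exact local_pos ν (hm I0 hI0) (h𝓑 I0) (hKbelow I0 hKI0) (hmono hKI0 _ (hat k w))
  set B' : ℝ := 𝒥.card * B with hB'def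
  have hB'0 : 0 ≤ B' := by positivity
  have H3 : ∀ᵐ x ∂m, ∀ (k : ℕ) (w : Finset ℕ) (c : ℚ), (∀ K ∈ S', x ∈ A K) →
      0 < ∑ I ∈ 𝒥, newb ν 𝓑 S' K I0 (atomSet D k w) b c B' I x →
      ∃ C : Finset (Fin n) → Set Ω, (∀ K ∈ S', MeasurableSet[𝓑 K] (C K) ∧ C K ⊆ A K) ∧
      0 < ∫ x in ⋂ K ∈ S', C K, ∑ I ∈ 𝒥, newb ν 𝓑 S' K I0 (atomSet D k w) b c B' I x ∂ν := by
    rw [ae_all_iff]; intro k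
    rw [ae_all_iff]; intro w
    rw [ae_all_iff]; intro c
    refine IH _ (fun I hI => newb_meas h𝓑 hmono hri hKI0 _ b hbout _ _ I hI) ⟨_, ?_, fun I hI =>
      newb_bdd h𝓑 hmono hri b hB0 hB c hB'0 I hI⟩
    positivity
  filter_upwards [H1, H2, H3] with x h1 h2 h3 hxA hxpos
  -- choose the scale
  have hT : Filter.Tendsto (fun k => ∑ I ∈ 𝒥, if K ⊆ I then
      ν[b I|Fs 𝓑 (below S' I) ⊔ finAlg D k] x else b I x) Filter.atTop
      (nhds (∑ I ∈ 𝒥, b I x)) := by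
    refine tendsto_finsetSum _ fun I hI => ?_
    by_cases hKI : K ⊆ I
    · simpa [hKI] using (h1 I hI hKI).1
    · simp [hKI]
  obtain ⟨k, hk, hk1⟩ := ((hT.eventually (lt_mem_nhds hxpos)).and
    (Filter.eventually_ge_atTop 1)).exists
  set w := (Finset.range k).filter (fun j => x ∈ D j) with hw
  have hxat : x ∈ atomSet D k w := by
    intro j hj
    simp [hw, hj]
  set g := cden ν (Fs 𝓑 (below S' K)) (atomSet D k w) x with hg
  have hgpos : 0 < g := h2 k w hxat
  let φ : ℝ → ℝ := fun c => (∑ I ∈ 𝒥, if K ⊆ I then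
      ν[b I|Fs 𝓑 (below S' I) ⊔ finAlg D k] x * g else c * b I x) - B' * |g - c|
  have hφc : Continuous φ := by
    refine Continuous.sub (continuous_finsetSum _ fun I _ => ?_) (by fun_prop)
    by_cases hKI : K ⊆ I
    · simp only [hKI, if_true]; fun_prop
    · simp only [hKI, if_false]; fun_prop
  have hφg : 0 < φ g := by
    have : φ g = g * (∑ I ∈ 𝒥, if K ⊆ I then
        ν[b I|Fs 𝓑 (below S' I) ⊔ finAlg D k] x else b I x) := by
      simp only [φ, sub_self, abs_zero, mul_zero, sub_zero, Finset.mul_sum]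
      refine Finset.sum_congr rfl fun I _ => ?_
      split_ifs <;> ring
    rw [this]; exact mul_pos hgpos hk
  obtain ⟨c, hc⟩ := (Rat.denseRange_cast (𝕜 := ℝ)).exists_mem_open
    (isOpen_lt continuous_const hφc) ⟨g, hφg⟩
  have hc : 0 < φ c := hc
  have hsum : ∑ I ∈ 𝒥, newb ν 𝓑 S' K I0 (atomSet D k w) b c B' I x = φ c := by
    rw [newb_sum 𝒥 S' K I0 hI0 hKI0]
    simp only [φ, ← hg]
    congr 1
    refine Finset.sum_congr rfl fun I hI => ?_
    by_cases hKI : K ⊆ I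
    · simp only [hKI, if_true]; exact (h1 I hI hKI).2 k w hxat
    · simp only [hKI, if_false]
  obtain ⟨C', hC', hpos⟩ := h3 k w c (fun T hT => hxA T (Finset.mem_of_mem_erase hT))
    (hsum ▸ hc)
  refine ⟨Function.update C' K (atomSet D k w), ?_, ?_⟩
  · intro T hTS
    by_cases h : T = K
    · subst h
      simp only [Function.update_self]
      refine ⟨hat k w, ?_⟩
      intro z hz
      have h0 := (hz 0 (by omega)).2 (((hxat 0 (by omega)).1 (hD0 ▸ hxA T hTS)))
      rwa [hD0] at h0
    · simp only [Function.update_of_ne h]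
      exact hC' T (Finset.mem_erase.2 ⟨h, hTS⟩)
  · have e : (⋂ T ∈ S, Function.update C' K (atomSet D k w) T) =
        (⋂ T ∈ S', C' T) ∩ atomSet D k w := by
      rw [← Finset.insert_erase hK, Finset.set_biInter_insert, inter_comm]
      congr 1
      · refine iInter₂_congr fun T hT => ?_
        rw [Function.update_of_ne (Finset.ne_of_mem_erase hT)]
      · simp
    rw [e]
    refine hpos.trans_le (step_int h𝓑 hmono hri hS' 𝒥 hI0 hKI0 (hat k w) ?_
      (fun I hI => (hb I hI).mono (hFSI I)) (fun I hI h => (hbout I hI h).mono (Fs_mono 𝓑 ?_))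
      hB0 hB c)
    · exact Finset.measurableSet_biInter _ fun T hT => le_Fs 𝓑 hT _ (hC' T hT).1
    · intro T hT; exact (mem_below.1 hT).1

lemma Lin (m : OuterMeasure Ω) (𝒥 : Finset (Finset (Fin n)))
    (hm : ∀ I ∈ 𝒥, ∀ N, MeasurableSet[𝓑 I] N → ν N = 0 → m N = 0) (k : ℕ) :
    ∀ (S : Finset (Finset (Fin n))) (_ : S.card = k) (_ : ∀ K ∈ S, ∀ K' ⊆ K, K' ∈ S)
    (_ : ∀ K ∈ S, ∃ I ∈ 𝒥, K ⊆ I)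
    (A : Finset (Fin n) → Set Ω) (_ : ∀ K ∈ S, MeasurableSet[𝓑 K] (A K))
    (b : Finset (Fin n) → Ω → ℝ) (_ : ∀ I ∈ 𝒥, StronglyMeasurable[Fs 𝓑 (below S I)] (b I))
    (_ : ∃ B : ℝ, 0 ≤ B ∧ ∀ I ∈ 𝒥, ∀ᵐ x ∂ν, |b I x| ≤ B),
    LinConcl ν 𝓑 m 𝒥 S A b := by
  induction k with
  | zero =>
    intro S hS0 _ _ A _ b hb _
    obtain rfl := Finset.card_eq_zero.1 hS0
    refine Filter.Eventually.of_forall fun x _ hx => ⟨fun _ => univ, by simp, ?_⟩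
    have hconst : ∀ I ∈ 𝒥, ∀ y, b I y = b I x := by
      intro I hI y
      have h := (hb I hI).measurable
      have e : Fs 𝓑 (below (∅ : Finset (Finset (Fin n))) I) = ⊥ := by
        simp [Fs, below]
      rw [e] at h
      have h' := h (measurableSet_singleton (b I x))
      rw [MeasurableSpace.measurableSet_bot_iff] at h'
      rcases h' with h' | h'
      · have : x ∈ b I ⁻¹' {b I x} := rfl
        rw [h'] at this; exact this.elim
      · have : y ∈ b I ⁻¹' {b I x} := by rw [h']; trivial
        exact this
    have : ∀ y, ∑ I ∈ 𝒥, b I y = ∑ I ∈ 𝒥, b I x := fun y =>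
      Finset.sum_congr rfl fun I hI => hconst I hI y
    simp only [this]
    simpa using hx
  | succ k ih =>
    intro S hSk hS hSJ A hA b hb ⟨B, hB0, hB⟩
    have hne : S.Nonempty := Finset.card_pos.1 (by omega)
    obtain ⟨K, hK, hKmax⟩ := Finset.exists_max_image S Finset.card hne
    obtain ⟨I0, hI0, hKI0⟩ := hSJ K hK
    have hKm : ∀ K' ∈ S, K ⊆ K' → K' = K := fun K' hK' h =>
      (Finset.eq_of_subset_of_card_le h (hKmax K' hK')).symm
    refine Lin_step h𝓑 hmono hri m 𝒥 hm hS hK hKm hI0 hKI0 A hA b hb hB0 hB ?_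
    intro b' hb' hB'
    refine ih (S.erase K) (by rw [Finset.card_erase_of_mem hK]; omega) ?_
      (fun T hT => hSJ T (Finset.mem_of_mem_erase hT)) A
      (fun T hT => hA T (Finset.mem_of_mem_erase hT)) b' hb' hB'
    intro T hT T' hT'
    rw [Finset.mem_erase] at hT ⊢
    refine ⟨?_, hS T hT.2 T' hT'⟩
    rintro rfl
    exact hT.1 (hKm T hT.2 hT')

theorem abstract_main (m : OuterMeasure Ω) (𝒥 : Finset (Finset (Fin n))) (h𝒥 : 𝒥.Nonempty)
    (hm : ∀ I ∈ 𝒥, ∀ N, MeasurableSet[𝓑 I] N → ν N = 0 → m N = 0)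
    (A : Finset (Fin n) → Set Ω) (hA : ∀ I ∈ 𝒥, MeasurableSet[𝓑 I] (A I)) :
    ∀ᵐ x ∂m, (∀ I ∈ 𝒥, x ∈ A I) → 0 < ν (⋂ I ∈ 𝒥, A I) := by
  classical
  let S : Finset (Finset (Fin n)) := Finset.univ.filter fun K => ∃ I ∈ 𝒥, K ⊆ I
  obtain ⟨I0, hI0⟩ := h𝒥
  have hS : ∀ K, K ∈ S ↔ ∃ I ∈ 𝒥, K ⊆ I := by simp [S]
  have h𝒥S : ∀ I ∈ 𝒥, I ∈ S := fun I hI => (hS I).2 ⟨I, hI, subset_rfl⟩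
  have := Lin h𝓑 hmono hri m 𝒥 hm S.card S rfl
    (fun K hK K' hK' => by
      rw [hS] at hK ⊢
      obtain ⟨I, hI, h⟩ := hK
      exact ⟨I, hI, hK'.trans h⟩) (fun K hK => (hS K).1 hK)
    (fun I => if I ∈ 𝒥 then A I else univ) (fun K _ => by
      by_cases h : K ∈ 𝒥
      · simpa [h] using hA K h
      · simp [h])
    (fun I _ => if I = I0 then 1 else 0) (fun I _ => stronglyMeasurable_const)
    ⟨1, zero_le_one, fun I _ => Filter.Eventually.of_forall fun x => by
      split_ifs <;> simp⟩
  filter_upwards [this] with x hx hxA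
  obtain ⟨C, hC, hpos⟩ := hx (fun K _ => by
    by_cases h : K ∈ 𝒥
    · simpa [h] using hxA K h
    · simp [h]) (by simp [hI0])
  simp only [Finset.sum_ite_eq', hI0, if_true] at hpos
  rw [pos_iff_ne_zero]
  intro h0
  have hsub : (⋂ K ∈ S, C K) ⊆ ⋂ I ∈ 𝒥, A I := by
    refine subset_iInter₂ fun I hI => ?_
    refine (biInter_subset_of_mem (h𝒥S I hI)).trans ?_
    have := (hC I (h𝒥S I hI)).2
    simpa [hI] using this
  have h0' := measure_mono_null hsub h0
  rw [Measure.restrict_eq_zero.2 h0'] at hpos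
  simp at hpos
end Lin

section P2
variable {L : FirstOrder.Language} {M : Type*} [L.Structure M]

/-- substituting variables and constants into a definable set -/
lemma def_subst {α β : Type*} {t : Set (α → M)} (ht : (univ : Set M).Definable L t)
    (u : α → β ⊕ M) :
    (univ : Set M).Definable L {z : β → M | (fun i => Sum.elim z id (u i)) ∈ t} := by
  rw [Set.definable_iff_exists_formula_sum] at ht ⊢
  obtain ⟨φ, rfl⟩ := ht
  refine ⟨φ.relabel (Sum.elim Sum.inl fun i =>
    Sum.elim (fun b => Sum.inr b) (fun a => Sum.inl ⟨a, trivial⟩) (u i)), ?_⟩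
  ext z
  simp only [mem_ofPred_eq, FirstOrder.Language.Formula.realize_relabel]
  refine iff_of_eq (congrArg _ ?_)
  funext i
  rcases i with i | i
  · rfl
  · simp only [Sum.elim_inr, Function.comp_apply]
    cases u i <;> rfl

lemma def_meas {α : Type*} {t : Set (α → M)} (ht : (univ : Set M).Definable L t) :
    MeasurableSet[defSigma L M α] t := MeasurableSpace.measurableSet_generateFrom ht

lemma subst_measurable {α β : Type*} (u : α → β ⊕ M) :
    Measurable[defSigma L M β, defSigma L M α] (fun (z : β → M) i => Sum.elim z id (u i)) :=
  @measurable_generateFrom _ _ (defSigma L M β) _ _ fun _ ht => def_meas (def_subst ht u)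

variable {n : ℕ}

lemma proj_measurable (I : Finset (Fin n)) :
    Measurable[defSigma L M (Fin n), defSigma L M ↥I] (proj M n I) :=
  subst_measurable (L := L) (M := M) (fun i : ↥I => (Sum.inl (i : Fin n) : Fin n ⊕ M))

lemma proj_preimage_def (I : Finset (Fin n)) {t : Set (↥I → M)}
    (ht : (univ : Set M).Definable L t) :
    (univ : Set M).Definable L (proj M n I ⁻¹' t) :=
  def_subst (L := L) (M := M) ht (fun i : ↥I => (Sum.inl (i : Fin n) : Fin n ⊕ M))

lemma proj_image_def (I : Finset (Fin n)) {t : Set (Fin n → M)}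
    (ht : (univ : Set M).Definable L t) :
    (univ : Set M).Definable L (proj M n I '' t) :=
  ht.image_comp (fun i : ↥I => (i : Fin n))

variable (L M n) in
/-- the σ-algebra of cylinder sets over `I` -/
def cyl (I : Finset (Fin n)) : MeasurableSpace (Fin n → M) :=
  (defSigma L M ↥I).comap (proj M n I)

lemma cyl_le (I : Finset (Fin n)) : cyl L M n I ≤ defSigma L M (Fin n) :=
  (proj_measurable I).comap_le

lemma cyl_mono : Monotone (cyl L M n) := by
  intro I I' h
  have e : proj M n I = (fun (z : ↥I' → M) (i : ↥I) => z ⟨i, h i.2⟩) ∘ proj M n I' := rfl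
  unfold cyl
  rw [e, ← MeasurableSpace.comap_comp]
  refine MeasurableSpace.comap_mono (Measurable.comap_le ?_)
  exact subst_measurable (L := L) (M := M)
    (fun i : ↥I => (Sum.inl (⟨i, h i.2⟩ : ↥I') : ↥I' ⊕ M))

lemma glue_measurable (W : Finset (Fin n)) (y : ↥(Wᶜ) → M) :
    Measurable[defSigma L M ↥W, defSigma L M (Fin n)] (fun x => glue M n W x y) := by
  have := subst_measurable (L := L) (M := M) (fun i : Fin n =>
    (if h : i ∈ W then Sum.inl ⟨i, h⟩ else Sum.inr (y ⟨i, Finset.mem_compl.mpr h⟩) : ↥W ⊕ M))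
  convert this using 3 with x i
  unfold glue
  split_ifs <;> rfl

lemma sig_measurable (I : Finset (Fin n)) (S : Finset (Finset (Fin n)))
    (hS : ∀ K ∈ S, ∀ K' ⊆ K, K' ∈ S) (y : ↥(Iᶜ) → M) :
    Measurable[Fs (cyl L M n) (below S I), Fs (cyl L M n) S]
      (fun x => glue M n I (proj M n I x) y) := by
  rw [measurable_iff_comap_le]
  unfold Fs
  simp only [MeasurableSpace.comap_iSup]
  refine iSup₂_le fun K hK => ?_
  have hK' : K ∩ I ∈ below S I :=
    mem_below.2 ⟨hS K hK _ Finset.inter_subset_left, Finset.inter_subset_right⟩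
  refine le_trans ?_ (le_Fs (cyl L M n) hK')
  unfold cyl
  rw [MeasurableSpace.comap_comp]
  have e : proj M n K ∘ (fun x => glue M n I (proj M n I x) y) =
      (fun (z : ↥(K ∩ I) → M) (i : ↥K) => Sum.elim z id
        (if h : (i : Fin n) ∈ I then Sum.inl ⟨i, Finset.mem_inter.2 ⟨i.2, h⟩⟩
          else Sum.inr (y ⟨i, Finset.mem_compl.mpr h⟩) : ↥(K ∩ I) ⊕ M)) ∘ proj M n (K ∩ I) := by
    funext x i
    simp only [Function.comp_apply, proj, glue]
    split_ifs <;> rfl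
  rw [e, ← MeasurableSpace.comap_comp]
  exact MeasurableSpace.comap_mono (subst_measurable _).comap_le

lemma cyl_invariant {I : Finset (Fin n)} {f : (Fin n → M) → ℝ} (hf : Measurable[cyl L M n I] f)
    {x x' : Fin n → M} (h : proj M n I x = proj M n I x') : f x = f x' := by
  obtain ⟨t, _, ht⟩ := hf (measurableSet_singleton (f x'))
  have : x ∈ f ⁻¹' {f x'} := by
    rw [← ht, mem_preimage, h, ← mem_preimage, ht]; rfl
  exact this

lemma proj_glue (I : Finset (Fin n)) (x : ↥I → M) (y : ↥(Iᶜ) → M) :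
    proj M n I (glue M n I x y) = x := by
  funext i
  simp [proj, glue]

lemma fub_set {ν : @Measure (Fin n → M) (defSigma L M (Fin n))} 
    (hfub : FubiniCond L M n ν) (I : Finset (Fin n)) {h : (Fin n → M) → ℝ}
    (hh : Measurable[cyl L M n I] h) {B : ℝ} (hB : ∀ᵐ x ∂ν, |h x| ≤ B) (D : Set (Fin n → M))
    (hD : MeasurableSet[defSigma L M (Fin n)] D) :
    ∫ x in D, h x ∂ν = ∫ y, (∫ x in (fun x => glue M n I (proj M n I x) y) ⁻¹' D, h x ∂ν)
      ∂(nuI L M n ν Iᶜ) := by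
  letI : MeasurableSpace (Fin n → M) := defSigma L M (Fin n)
  letI : MeasurableSpace (↥I → M) := defSigma L M ↥I
  have hh0 : Measurable h := hh.mono (cyl_le I) le_rfl
  have hind : Measurable (D.indicator h) := hh0.indicator hD
  rw [← integral_indicator hD, hfub I (D.indicator h) hind ⟨B, by
    filter_upwards [hB] with x hx
    by_cases hxD : x ∈ D
    · simpa [hxD] using hx
    · simpa [hxD] using (abs_nonneg _).trans hx⟩]
  congr 1
  funext y
  have hp : Measurable (proj M n I) := proj_measurable (L := L) I
  have hg : Measurable (fun x => glue M n I x y) := glue_measurable (L := L) I y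
  have hs : MeasurableSet ((fun x => glue M n I (proj M n I x) y) ⁻¹' D) := (hg.comp hp) hD
  rw [← integral_indicator hs]
  unfold nuI
  have hcomp : Measurable (fun x => D.indicator h (glue M n I x y)) := hind.comp hg
  rw [integral_map hp.aemeasurable hcomp.aestronglyMeasurable]
  congr 1
  funext x
  simp only [indicator, mem_preimage]
  rw [cyl_invariant hh (proj_glue I (proj M n I x) y)]
  rfl

lemma relIndep {ν : @Measure (Fin n → M) (defSigma L M (Fin n))} 
    (hprob : ν univ = 1)
    (hfub : FubiniCond L M n ν) : RelIndep ν (cyl L M n) := by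
  letI m0 : MeasurableSpace (Fin n → M) := defSigma L M (Fin n)
  haveI : IsProbabilityMeasure ν := ⟨hprob⟩
  intro I S hS f hf ⟨B, hB⟩
  have hB0 : ∀ᵐ x ∂ν, |f x| ≤ |B| := by
    filter_upwards [hB] with x hx using hx.trans (le_abs_self B)
  have hGH : Fs (cyl L M n) (below S I) ≤ Fs (cyl L M n) S :=
    Fs_mono _ fun T hT => (mem_below.1 hT).1
  have hH : Fs (cyl L M n) S ≤ m0 := Fs_le fun K _ => cyl_le K
  have hGI : Fs (cyl L M n) (below S I) ≤ cyl L M n I :=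
    Fs_le fun T hT => cyl_mono (mem_below.1 hT).2
  have hfi : Integrable f ν :=
    integrable_of_bdd ((hf.mono (cyl_le I)).aestronglyMeasurable) hB
  have hgB : ∀ᵐ x ∂ν, |ν[f|Fs (cyl L M n) (below S I)] x| ≤ |B| :=
    ae_bdd_abs_condExp_of_ae_bdd_abs hB0
  symm
  refine ae_eq_condExp_of_forall_setIntegral_eq hH hfi
    (fun s _ _ => integrable_condExp.integrableOn) ?_
    ((stronglyMeasurable_condExp.mono hGH).aestronglyMeasurable)
  intro D hD _
  rw [fub_set hfub I ((stronglyMeasurable_condExp.mono hGI).measurable) hgB D (hH _ hD),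
    fub_set hfub I hf.measurable hB D (hH _ hD)]
  congr 1
  funext y
  exact setIntegral_condExp (hGH.trans hH) hfi (sig_measurable I S hS y hD)

end P2

section P3

lemma outer_le {X : Type*} (𝒟 : Set (Set X)) (h0 : ∅ ∈ 𝒟) (hcompl : ∀ s ∈ 𝒟, sᶜ ∈ 𝒟)
    (hinter : ∀ s ∈ 𝒟, ∀ t ∈ 𝒟, s ∩ t ∈ 𝒟)
    (μ : @Measure X (MeasurableSpace.generateFrom 𝒟)) (hμ : μ univ = 1) (m : OuterMeasure X)
    (κ : NNReal) (hκ : 0 < κ) (hm : ∀ s ∈ 𝒟, m s ≤ κ * μ s) (N : Set X)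
    (hN : MeasurableSet[MeasurableSpace.generateFrom 𝒟] N) : m N ≤ κ * μ N := by
  classical
  letI ms : MeasurableSpace X := MeasurableSpace.generateFrom 𝒟
  haveI : IsProbabilityMeasure μ := ⟨hμ⟩
  let f : Set X → ℝ≥0∞ := fun s => if s ∈ 𝒟 then μ s else ⊤
  have hf0 : f ∅ = 0 := by simp [f, h0]
  have hD : ∀ s ∈ 𝒟, MeasurableSet s := fun s hs => MeasurableSpace.measurableSet_generateFrom hs
  let ρ := OuterMeasure.ofFunction f hf0
  have hcar : ms ≤ ρ.caratheodory := by
    refine MeasurableSpace.generateFrom_le fun s hs => ?_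
    refine OuterMeasure.ofFunction_caratheodory fun t => ?_
    by_cases ht : t ∈ 𝒟
    · have h1 : t ∩ s ∈ 𝒟 := hinter t ht s hs
      have h2 : t \ s ∈ 𝒟 := hinter t ht _ (hcompl s hs)
      simp only [f, ht, h1, h2, if_true]
      exact (measure_inter_add_sdiff t (hD s hs)).le
    · simp [f, ht]
  have hle : μ.toOuterMeasure ≤ ρ := by
    rw [OuterMeasure.le_ofFunction]
    intro s
    by_cases hs : s ∈ 𝒟
    · simp [f, hs]
    · simp [f, hs]
  have heq : ∀ s ∈ 𝒟, ρ s = μ s := by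
    intro s hs
    refine le_antisymm ((OuterMeasure.ofFunction_le s).trans (by simp [f, hs])) (hle s)
  have huniv : univ ∈ 𝒟 := by simpa using hcompl _ h0
  have hext : μ = ρ.toMeasure hcar := by
    refine ext_of_generate_finite 𝒟 rfl (fun s hs t ht _ => hinter s hs t ht) ?_ ?_
    · intro s hs
      rw [toMeasure_apply _ _ (hD s hs), heq s hs]
    · rw [toMeasure_apply _ _ MeasurableSet.univ, heq _ huniv]
  have hmle : m ≤ (κ : ℝ≥0∞) • ρ := by
    rw [OuterMeasure.smul_ofFunction ENNReal.coe_ne_top, OuterMeasure.le_ofFunction]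
    intro s
    by_cases hs : s ∈ 𝒟
    · simpa [f, hs] using hm s hs
    · simp only [f, hs, Pi.smul_apply, if_false, smul_eq_mul]
      rw [ENNReal.mul_top (by exact_mod_cast hκ.ne')]
      exact le_top
  refine (hmle N).trans ?_
  rw [hext, toMeasure_apply _ _ hN]
  rfl

variable {L : FirstOrder.Language} {M : Type*} [L.Structure M] {n : ℕ}

lemma null_transfer {ν : @Measure (Fin n → M) (defSigma L M (Fin n))} (hprob : ν univ = 1)
    (m : OuterMeasure (Fin n → M)) (κ : NNReal) (hκ : 0 < κ) (I : Finset (Fin n))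
    (hm : ∀ s : Set (↥I → M), (univ : Set M).Definable L s →
      m (proj M n I ⁻¹' s) ≤ κ * nuI L M n ν I s)
    (N : Set (Fin n → M)) (hN : MeasurableSet[cyl L M n I] N) (h0 : ν N = 0) : m N = 0 := by
  obtain ⟨N', hN', rfl⟩ := hN
  have hp : Measurable[defSigma L M (Fin n), defSigma L M ↥I] (proj M n I) := proj_measurable I
  have hu : nuI L M n ν I univ = 1 := by
    unfold nuI
    rw [Measure.map_apply hp MeasurableSet.univ]
    simpa using hprob
  have h : OuterMeasure.map (proj M n I) m N' ≤ κ * nuI L M n ν I N' := outer_le {s : Set (↥I → M) | (univ : Set M).Definable L s} Set.definable_empty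
    (fun s hs => hs.compl) (fun s hs t ht => hs.inter ht) (nuI L M n ν I) hu
    (OuterMeasure.map (proj M n I) m) κ hκ (fun s hs => hm s hs) N' hN'
  rw [OuterMeasure.map_apply] at h
  have e : nuI L M n ν I N' = 0 := by
    unfold nuI
    rwa [Measure.map_apply hp hN']
  rw [e, mul_zero] at h
  exact le_antisymm h bot_le
end P3

section P4

lemma fin_to_one {X Y : Type*} [MeasurableSpace X] [StandardBorelSpace X] [MeasurableSpace Y]
    [StandardBorelSpace Y] (l : ℕ) : ∀ (G : Set (X × Y)), MeasurableSet G →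
    (∀ y, {x | (x, y) ∈ G}.Finite ∧ {x | (x, y) ∈ G}.ncard ≤ l) →
    MeasurableSet (Prod.snd '' G) := by
  classical
  induction l with
  | zero =>
    intro G _ hG
    have : G = ∅ := by
      ext ⟨x, y⟩
      have h1 := (Set.ncard_eq_zero (hG y).1).1 (Nat.le_zero.1 (hG y).2)
      have : x ∉ {x | (x, y) ∈ G} := by rw [h1]; simp
      simpa using this
    simp [this]
  | succ l ih =>
    intro G hGm hG
    let e : X → ℝ := embeddingReal X
    have he : MeasurableEmbedding e := measurableEmbedding_embeddingReal X
    let T : Set ((Fin (l + 1) → X) × Y) :=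
      {p | (∀ i j, i < j → e (p.1 i) < e (p.1 j)) ∧ ∀ i, (p.1 i, p.2) ∈ G}
    have hTm : MeasurableSet T := by
      have e1 : T = (⋂ i, ⋂ j, ⋂ (_ : i < j), {p | e (p.1 i) < e (p.1 j)}) ∩
          ⋂ i, (fun p : (Fin (l + 1) → X) × Y => (p.1 i, p.2)) ⁻¹' G := by
        ext p; simp [T]
      rw [e1]
      refine MeasurableSet.inter ?_ ?_
      · refine MeasurableSet.iInter fun i => MeasurableSet.iInter fun j =>
          MeasurableSet.iInter fun _ => ?_
        exact measurableSet_lt (he.measurable.comp ((measurable_pi_apply i).comp measurable_fst))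
          (he.measurable.comp ((measurable_pi_apply j).comp measurable_fst))
      · refine MeasurableSet.iInter fun i => ?_
        exact (((measurable_pi_apply i).comp measurable_fst).prodMk measurable_snd) hGm
    have hcard : ∀ p ∈ T, ∀ h : {x | (x, p.2) ∈ G}.Finite, (h.toFinset.image e).card = l + 1 := by
      intro p hp h
      apply le_antisymm
      · rw [Finset.card_image_of_injective _ he.injective, ← Set.ncard_eq_toFinset_card _ h]
        exact (hG p.2).2
      · have hinj : Function.Injective (fun i => e (p.1 i)) :=
          StrictMono.injective (f := fun i => e (p.1 i)) fun i j hij => hp.1 i j hij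
        have := Finset.card_le_card_of_injOn (s := (Finset.univ : Finset (Fin (l + 1))))
          (t := h.toFinset.image e) (fun i => e (p.1 i)) (fun i _ => by
            have : p.1 i ∈ h.toFinset := by simpa using hp.2 i
            simpa using Finset.mem_image_of_mem e this) hinj.injOn
        simpa using this
    have hinj : InjOn Prod.snd T := by
      rintro ⟨p, y⟩ hp ⟨p', y'⟩ hp' h
      obtain rfl : y = y' := h
      have h := (hG y).1
      have h1 := Finset.orderEmbOfFin_unique (hcard _ hp h) (f := fun i => e (p i)) (fun i => by
        refine Finset.mem_image_of_mem e ?_; simpa using hp.2 i) fun i j hij => hp.1 i j hij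
      have h2 := Finset.orderEmbOfFin_unique (hcard _ hp h) (f := fun i => e (p' i)) (fun i => by
        refine Finset.mem_image_of_mem e ?_; simpa using hp'.2 i) fun i j hij => hp'.1 i j hij
      have : p = p' := by
        funext i
        exact he.injective (congrFun (h1.trans h2.symm) i)
      rw [this]
    have hC : MeasurableSet (Prod.snd '' T) :=
      hTm.image_of_measurable_injOn measurable_snd hinj
    have hfull : ∀ y, {x | (x, y) ∈ G}.ncard = l + 1 → y ∈ Prod.snd '' T := by
      intro y hy
      have h := (hG y).1
      have hc : (h.toFinset.image e).card = l + 1 := by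
        rw [Finset.card_image_of_injective _ he.injective, ← Set.ncard_eq_toFinset_card _ h, hy]
      have hmem : ∀ i, ∃ x, (x, y) ∈ G ∧ e x = (h.toFinset.image e).orderEmbOfFin hc i := by
        intro i
        have := Finset.orderEmbOfFin_mem (h.toFinset.image e) hc i
        obtain ⟨x, hx, hx'⟩ := Finset.mem_image.1 this
        exact ⟨x, by simpa using hx, hx'⟩
      choose p hp1 hp2 using hmem
      refine ⟨(p, y), ⟨fun i j hij => ?_, hp1⟩, rfl⟩
      simp only [hp2]
      exact (Finset.orderEmbOfFin _ hc).strictMono hij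
    have hG' : MeasurableSet (Prod.snd '' (G ∩ (Prod.snd ⁻¹' (Prod.snd '' T))ᶜ)) := by
      refine ih _ (hGm.inter (measurable_snd hC).compl) fun y => ?_
      have hsub : {x | (x, y) ∈ G ∩ (Prod.snd ⁻¹' (Prod.snd '' T))ᶜ} ⊆ {x | (x, y) ∈ G} :=
        fun x hx => hx.1
      refine ⟨(hG y).1.subset hsub, ?_⟩
      by_cases hy : y ∈ Prod.snd '' T
      · have : {x | (x, y) ∈ G ∩ (Prod.snd ⁻¹' (Prod.snd '' T))ᶜ} = ∅ := by
          ext x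
          constructor
          · intro hx; exact absurd hy hx.2
          · intro hx; exact hx.elim
        rw [this]; simp
      · have h1 := Set.ncard_le_ncard hsub (hG y).1
        have h2 := (hG y).2
        have h3 : {x | (x, y) ∈ G}.ncard ≠ l + 1 := fun h => hy (hfull y h)
        omega
    have : Prod.snd '' G = Prod.snd '' T ∪
        Prod.snd '' (G ∩ (Prod.snd ⁻¹' (Prod.snd '' T))ᶜ) := by
      ext y
      constructor
      · rintro ⟨⟨x, y⟩, hx, rfl⟩
        by_cases hy : y ∈ Prod.snd '' T
        · exact Or.inl hy
        · exact Or.inr ⟨(x, y), ⟨hx, hy⟩, rfl⟩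
      · rintro (⟨⟨p, y⟩, hp, rfl⟩ | ⟨⟨x, y⟩, hx, rfl⟩)
        · exact ⟨(p 0, y), hp.2 0, rfl⟩
        · exact ⟨(x, y), hx.1, rfl⟩
    rw [this]
    exact hC.union hG'

variable {L : FirstOrder.Language} {M : Type*} [L.Structure M]

lemma sat_one (hsat : Aleph1Saturated L M) {α : Type*} [DecidableEq α] (i : α) (x : α → M)
    (D : ℕ → Set (α → M)) (hD : ∀ j, (univ : Set M).Definable L (D j)) (hanti : Antitone D)
    (h : ∀ j, ∃ c, Function.update x i c ∈ D j) : ∃ c, ∀ j, Function.update x i c ∈ D j := by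
  simp only [Set.definable_iff_exists_formula_sum] at hD
  choose φ hφ using hD
  let ψ : ℕ → L.Formula (M ⊕ Fin 1) := fun j => (φ j).relabel
    (Sum.elim (fun a => Sum.inl a.1) fun k => if k = i then Sum.inr 0 else Sum.inl (x k))
  have hψ : ∀ j c, (ψ j).Realize (Sum.elim id fun _ => c) ↔ Function.update x i c ∈ D j := by
    intro j c
    rw [hφ j]
    simp only [ψ, FirstOrder.Language.Formula.realize_relabel, mem_ofPred_eq]
    refine iff_of_eq (congrArg _ ?_)
    funext k
    rcases k with k | k
    · rfl
    · by_cases hk : k = i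
      · subst hk; simp
      · simp [hk]
  obtain ⟨c, hc⟩ := hsat (range ψ) (countable_range ψ) (by
    intro T hT
    have hT' : ∀ θ ∈ T, ∃ j, ψ j = θ := fun θ hθ => hT hθ
    choose! f hf using hT'
    obtain ⟨c, hc⟩ := h (T.sup f)
    refine ⟨c, fun θ hθ => ?_⟩
    rw [← hf θ hθ, hψ]
    exact hanti (Finset.le_sup hθ) hc)
  exact ⟨c, fun j => (hψ j c).1 (hc _ ⟨j, rfl⟩)⟩

lemma ex_def {α : Type*} [Finite α] [DecidableEq α] (a : α) {D : Set (α → M)}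
    (hD : (univ : Set M).Definable L D) :
    (univ : Set M).Definable L {z : α → M | ∃ c, Function.update z a c ∈ D} := by
  have h1 := hD.image_comp (fun i : {i // i ≠ a} => (i : α))
  have h2 := h1.preimage_comp (fun i : {i // i ≠ a} => (i : α))
  convert h2 using 1
  ext z
  constructor
  · rintro ⟨c, hc⟩
    refine ⟨_, hc, ?_⟩
    funext i
    simp [i.2]
  · rintro ⟨z', hz', h⟩
    refine ⟨z' a, ?_⟩
    convert hz' using 1
    funext i
    by_cases hi : i = a
    · subst hi; simp
    · simpa [hi] using (congrFun h ⟨i, hi⟩).symm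

lemma sat_fin (hsat : Aleph1Saturated L M) {α : Type*} [Finite α] [DecidableEq α] (W : Finset α) :
    ∀ (x : α → M) (D : ℕ → Set (α → M)) (_ : ∀ j, (univ : Set M).Definable L (D j))
    (_ : Antitone D) (_ : ∀ j, ∃ z ∈ D j, ∀ i ∉ W, z i = x i),
    ∃ z, (∀ j, z ∈ D j) ∧ ∀ i ∉ W, z i = x i := by
  induction W using Finset.induction_on with
  | empty =>
    intro x D _ _ h
    refine ⟨x, fun j => ?_, fun _ _ => rfl⟩
    obtain ⟨z, hz, hzx⟩ := h j
    have : z = x := funext fun i => hzx i (by simp)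
    exact this ▸ hz
  | insert a W ha ih =>
    intro x D hD hanti h
    obtain ⟨z, hz, hzx⟩ := ih x (fun j => {z : α → M | ∃ c, Function.update z a c ∈ D j})
      (fun j => ex_def a (hD j)) (fun j j' hjj' z ⟨c, hc⟩ => ⟨c, hanti hjj' hc⟩) (by
        intro j
        obtain ⟨z, hz, hzx⟩ := h j
        refine ⟨Function.update z a (x a), ⟨z a, by simpa using hz⟩, ?_⟩
        intro i hi
        by_cases hia : i = a
        · subst hia; simp
        · simp only [Function.update_of_ne hia]
          exact hzx i (by simp [hi, hia]))
    obtain ⟨c, hc⟩ := sat_one hsat a z D hD hanti hz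
    refine ⟨Function.update z a c, hc, fun i hi => ?_⟩
    simp only [Finset.mem_insert, not_or] at hi
    rw [Function.update_of_ne hi.1]
    exact hzx i hi.2

lemma sat_all (hsat : Aleph1Saturated L M) {α : Type*} [Fintype α] [DecidableEq α]
    (D : ℕ → Set (α → M)) (hD : ∀ j, (univ : Set M).Definable L (D j))
    (hanti : Antitone D) (h : ∀ j, (D j).Nonempty) : ∃ z, ∀ j, z ∈ D j := by
  obtain ⟨x, _⟩ := h 0
  obtain ⟨z, hz, _⟩ := sat_fin hsat Finset.univ x D hD hanti (fun j => by
    obtain ⟨z, hz⟩ := h j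
    exact ⟨z, hz, by simp⟩)
  exact ⟨z, hz⟩

lemma sat_fib (hsat : Aleph1Saturated L M) {n : ℕ} (I : Finset (Fin n)) (a : ↥I → M)
    (D : ℕ → Set (Fin n → M)) (hD : ∀ j, (univ : Set M).Definable L (D j))
    (hanti : Antitone D) (h : ∀ j, a ∈ proj M n I '' D j) :
    ∃ z, (∀ j, z ∈ D j) ∧ proj M n I z = a := by
  obtain ⟨x, _, hx⟩ := h 0
  obtain ⟨z, hz, hzx⟩ := sat_fin hsat Iᶜ x D hD hanti (fun j => by
    obtain ⟨z, hz, hza⟩ := h j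
    refine ⟨z, hz, fun i hi => ?_⟩
    have hi' : i ∈ I := by simpa using hi
    exact congrFun (hza.trans hx.symm) ⟨i, hi'⟩)
  refine ⟨z, hz, ?_⟩
  rw [← hx]
  funext i
  exact hzx i (by simp)

open Classical in
/-- the type of a tuple with respect to a sequence of sets -/
noncomputable def tp {X : Type*} (D : ℕ → Set X) (b : X) : ℕ → Bool := fun j => decide (b ∈ D j)

lemma tp_apply {X : Type*} (D : ℕ → Set X) (b : X) (j : ℕ) : tp D b j = true ↔ b ∈ D j := by
  simp [tp]

lemma tp_measurable {α : Type*} (D : ℕ → Set (α → M))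
    (hD : ∀ j, (univ : Set M).Definable L (D j)) : Measurable[defSigma L M α] (tp D) := by
  letI : MeasurableSpace (α → M) := defSigma L M α
  refine measurable_pi_lambda _ fun j => measurable_to_bool ?_
  have : (fun b => tp D b j) ⁻¹' {true} = D j := by
    ext b; exact tp_apply D b j
  rw [this]
  exact def_meas (hD j)

lemma atomSet_def {α : Type*} (D : ℕ → Set (α → M))
    (hD : ∀ j, (univ : Set M).Definable L (D j)) (k : ℕ) (w : Finset ℕ) :
    (univ : Set M).Definable L (atomSet D k w) := by
  induction k with
  | zero =>
    have : atomSet D 0 w = univ := by ext; simp [atomSet]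
    rw [this]; exact Set.definable_univ
  | succ k ih =>
    by_cases h : k ∈ w
    · have : atomSet D (k + 1) w = atomSet D k w ∩ D k := by
        ext z
        simp only [atomSet, Nat.forall_lt_succ_right, mem_inter_iff, mem_ofPred_eq, h, iff_true]
      rw [this]; exact ih.inter (hD k)
    · have : atomSet D (k + 1) w = atomSet D k w ∩ (D k)ᶜ := by
        ext z
        simp only [atomSet, Nat.forall_lt_succ_right, mem_inter_iff, mem_ofPred_eq, h, iff_false,
          mem_compl_iff]
      rw [this]; exact ih.inter (hD k).compl

/-- the finite set coding an initial segment of a Boolean sequence -/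
def code (x : ℕ → Bool) (k : ℕ) : Finset ℕ := (Finset.range k).filter fun j => x j = true

lemma mem_atomSet_code {X : Type*} (D : ℕ → Set X) (x : ℕ → Bool) (k : ℕ) (b : X) :
    b ∈ atomSet D k (code x k) ↔ ∀ j < k, tp D b j = x j := by
  simp only [atomSet, mem_ofPred_eq]
  refine forall₂_congr fun j hj => ?_
  have : j ∈ code x k ↔ x j = true := by simp [code, hj]
  rw [this, ← tp_apply D b j]
  exact Bool.eq_iff_iff.symm

lemma atomSet_code_anti {X : Type*} (D : ℕ → Set X) (x : ℕ → Bool) :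
    Antitone fun k => atomSet D k (code x k) := by
  intro k k' hk b hb
  rw [mem_atomSet_code] at hb ⊢
  exact fun j hj => hb j (hj.trans_le hk)

lemma range_tp_meas (hsat : Aleph1Saturated L M) {α : Type*} [Fintype α] [DecidableEq α]
    (D : ℕ → Set (α → M)) (hD : ∀ j, (univ : Set M).Definable L (D j)) :
    MeasurableSet (range (tp D)) := by
  have e : range (tp D) = ⋂ k, {y | (atomSet D k (code y k)).Nonempty} := by
    ext y
    simp only [mem_iInter, mem_ofPred_eq]
    constructor
    · rintro ⟨b, rfl⟩ k
      exact ⟨b, by rw [mem_atomSet_code]; exact fun _ _ => rfl⟩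
    · intro h
      obtain ⟨z, hz⟩ := sat_all hsat (fun k => atomSet D k (code y k))
        (fun k => atomSet_def D hD k _) (atomSet_code_anti D y) h
      refine ⟨z, funext fun j => ?_⟩
      exact (mem_atomSet_code D y (j + 1) z).1 (hz (j + 1)) j (by omega)
  rw [e]
  refine MeasurableSet.iInter fun k => ?_
  have hcode : Measurable fun y : ℕ → Bool => code y k := by
    refine measurable_to_countable' fun w => ?_
    have : (fun y : ℕ → Bool => code y k) ⁻¹' {w} =
        ⋂ j, {y | (j < k ∧ y j = true) ↔ j ∈ w} := by
      ext y
      simp [code, Finset.ext_iff]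
    rw [this]
    refine MeasurableSet.iInter fun j => ?_
    have : {y : ℕ → Bool | (j < k ∧ y j = true) ↔ j ∈ w} =
        (fun y : ℕ → Bool => y j) ⁻¹' {c | (j < k ∧ c = true) ↔ j ∈ w} := rfl
    rw [this]
    exact measurable_pi_apply j (MeasurableSet.of_discrete)
  exact hcode (MeasurableSet.of_discrete (s := {w : Finset ℕ | (atomSet D k w).Nonempty}))
end P4

section P5
variable {L : FirstOrder.Language} {M : Type*} [L.Structure M]

lemma exists_code_set {n : ℕ} {E : Set (Fin n → M)} (hE : MeasurableSet[defSigma L M (Fin n)] E) :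
    ∃ D : ℕ → Set (Fin n → M), (∀ j, (univ : Set M).Definable L (D j)) ∧
      ∃ E' : Set (ℕ → Bool), MeasurableSet E' ∧ E = tp D ⁻¹' E' := by
  obtain ⟨𝓓, h1, h2, h3⟩ := count_set ⊥ {s : Set (Fin n → M) | (univ : Set M).Definable L s} E
    (by rw [bot_sup_eq]; exact hE)
  rw [bot_sup_eq] at h3
  obtain ⟨D, hD⟩ := (h2.insert ∅).exists_eq_range ⟨∅, mem_insert _ _⟩
  have hDd : ∀ j, (univ : Set M).Definable L (D j) := by
    intro j
    have : D j ∈ insert ∅ 𝓓 := hD ▸ ⟨j, rfl⟩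
    rcases this with h | h
    · rw [h]; exact Set.definable_empty
    · exact h1 h
  have hle : MeasurableSpace.generateFrom 𝓓 ≤ MeasurableSpace.comap (tp D) inferInstance := by
    refine MeasurableSpace.generateFrom_le fun s hs => ?_
    have : s ∈ range D := hD ▸ mem_insert_of_mem _ hs
    obtain ⟨j, rfl⟩ := this
    refine ⟨(fun y : ℕ → Bool => y j) ⁻¹' {true}, measurable_pi_apply j (measurableSet_singleton _), ?_⟩
    ext b
    exact tp_apply D b j
  obtain ⟨E', hE', h⟩ := hle _ h3
  exact ⟨D, hDd, E', hE', h.symm⟩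

lemma image_meas (hsat : Aleph1Saturated L M) {n : ℕ} {E : Set (Fin n → M)}
    (hE : MeasurableSet[defSigma L M (Fin n)] E) (I : Finset (Fin n)) (l : ℕ)
    (hb : ∀ a : ↥I → M, (proj M n I ⁻¹' {a} ∩ E).Finite ∧ (proj M n I ⁻¹' {a} ∩ E).ncard ≤ l) :
    MeasurableSet[defSigma L M ↥I] (proj M n I '' E) := by
  classical
  obtain ⟨D, hD, E', hE', rfl⟩ := exists_code_set hE
  obtain ⟨e, he⟩ := exists_surjective_nat (ℕ × Finset ℕ)
  let P : ℕ → Set (↥I → M) := fun i => proj M n I '' atomSet D (e i).1 (e i).2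
  have hP : ∀ i, (univ : Set M).Definable L (P i) := fun i =>
    proj_image_def I (atomSet_def D hD _ _)
  let K : Set ((ℕ → Bool) × (ℕ → Bool)) :=
    {p | ∀ i, code p.1 (e i).1 = (e i).2 → p.2 i = true}
  have hcode : ∀ k, Measurable fun y : ℕ → Bool => code y k := by
    intro k
    refine measurable_to_countable' fun w => ?_
    have : (fun y : ℕ → Bool => code y k) ⁻¹' {w} =
        ⋂ j, {y | (j < k ∧ y j = true) ↔ j ∈ w} := by
      ext y
      simp [code, Finset.ext_iff]
    rw [this]
    refine MeasurableSet.iInter fun j => ?_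
    have : {y : ℕ → Bool | (j < k ∧ y j = true) ↔ j ∈ w} =
        (fun y : ℕ → Bool => y j) ⁻¹' {c | (j < k ∧ c = true) ↔ j ∈ w} := rfl
    rw [this]
    exact measurable_pi_apply j (MeasurableSet.of_discrete)
  have hK : MeasurableSet K := by
    have : K = ⋂ i, (((fun p : (ℕ → Bool) × (ℕ → Bool) => code p.1 (e i).1) ⁻¹' {(e i).2})ᶜ ∪
        (fun p : (ℕ → Bool) × (ℕ → Bool) => p.2 i) ⁻¹' {true}) := by
      ext p
      simp only [K, mem_iInter, mem_ofPred_eq, mem_union, mem_compl_iff, mem_preimage,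
        mem_singleton_iff, imp_iff_not_or]
    rw [this]
    refine MeasurableSet.iInter fun i => MeasurableSet.union (MeasurableSet.compl ?_) ?_
    · exact ((hcode _).comp measurable_fst) (MeasurableSet.of_discrete)
    · exact ((measurable_pi_apply i).comp measurable_snd) (measurableSet_singleton _)
  have key : ∀ x a, (x, tp P a) ∈ K → ∃ b, proj M n I b = a ∧ tp D b = x := by
    intro x a h
    obtain ⟨b, hb1, hb2⟩ := sat_fib hsat I a (fun k => atomSet D k (code x k))
      (fun k => atomSet_def D hD k _) (atomSet_code_anti D x) (fun k => by
        obtain ⟨i, hi⟩ := he (k, code x k)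
        have h1 := h i (by rw [hi])
        have h2 := (tp_apply P a i).1 h1
        simp only [P, hi] at h2
        exact h2)
    refine ⟨b, hb2, funext fun j => ?_⟩
    exact (mem_atomSet_code D x (j + 1) b).1 (hb1 (j + 1)) j (by omega)
  let G : Set ((ℕ → Bool) × (ℕ → Bool)) :=
    Prod.fst ⁻¹' E' ∩ Prod.snd ⁻¹' (range (tp P)) ∩ K
  have hG : MeasurableSet G := ((measurable_fst hE').inter
    (measurable_snd (range_tp_meas hsat P hP))).inter hK
  have hfib : ∀ y, {x | (x, y) ∈ G}.Finite ∧ {x | (x, y) ∈ G}.ncard ≤ l := by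
    intro y
    by_cases hy : y ∈ range (tp P)
    · obtain ⟨a, rfl⟩ := hy
      have hsub : {x | (x, tp P a) ∈ G} ⊆ tp D '' (proj M n I ⁻¹' {a} ∩ tp D ⁻¹' E') := by
        intro x hx
        obtain ⟨b, hb1, rfl⟩ := key x a hx.2
        exact ⟨b, ⟨hb1, hx.1.1⟩, rfl⟩
      have hfin := (hb a).1
      exact ⟨(hfin.image _).subset hsub, (Set.ncard_le_ncard hsub (hfin.image _)).trans
        ((Set.ncard_image_le hfin).trans (hb a).2)⟩
    · have : {x | (x, y) ∈ G} = ∅ := by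
        ext x
        constructor
        · intro hx; exact absurd hx.1.2 hy
        · intro hx; exact hx.elim
      rw [this]; simp
  have e1 : proj M n I '' (tp D ⁻¹' E') = tp P ⁻¹' (Prod.snd '' G) := by
    ext a
    constructor
    · rintro ⟨b, hbE, rfl⟩
      refine ⟨(tp D b, tp P (proj M n I b)), ⟨⟨hbE, ⟨_, rfl⟩⟩, ?_⟩, rfl⟩
      intro i hi
      rw [tp_apply]
      refine ⟨b, ?_, rfl⟩
      rw [← hi, mem_atomSet_code]
      exact fun _ _ => rfl
    · rintro ⟨⟨x, y⟩, hx, rfl⟩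
      obtain ⟨b, hb1, rfl⟩ := key x a hx.2
      exact ⟨b, hx.1.1, hb1⟩
  rw [e1]
  exact tp_measurable P hP (fin_to_one l G hG hfib)

end P5

/-- **Theorem 2.4 (main theorem)**: if `E ∈ B_V` satisfies
(a) `ν^J(π_J(E)) > 0`,
(b) fibres of `π_I` on `E` have at most `l` elements for each `(n−1)`-subset `I`, and
(c) `ν^J(π_J(F ∩ E)) ≤ k·ν^I(π_I(F ∩ E))` for all definable `F` and `(n−1)`-subsets `I`,
then `ν^V({b̄ : π_I(b̄) ∈ π_I(E) for all (n−1)-subsets I}) > 0`. -/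
theorem main_theorem
    (L : FirstOrder.Language) (M : Type*) [L.Structure M]
    [Countable (Σ l, L.Functions l)] [Countable (Σ l, L.Relations l)]
    (hsat : Aleph1Saturated L M)
    (n : ℕ) (hn : 2 ≤ n)
    (ν : @Measure (Fin n → M) (defSigma L M (Fin n)))
    (hprob : ν Set.univ = 1)
    (hdef : DefinabilityCond L M n ν)
    (hfub : FubiniCond L M n ν)
    (E : Set (Fin n → M))
    (hE : MeasurableSet[defSigma L M (Fin n)] E)
    (ha : 0 < nuI L M n ν (Jset n hn) (proj M n (Jset n hn) '' E))
    (l : ℕ)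
    (hb : ∀ I : Finset (Fin n), I.card = n - 1 → ∀ a : ↥I → M,
      (proj M n I ⁻¹' {a} ∩ E).Finite ∧ (proj M n I ⁻¹' {a} ∩ E).ncard ≤ l)
    (κ : NNReal) (hκ : 0 < κ)
    (hc : ∀ F : Set (Fin n → M), (Set.univ : Set M).Definable L F →
      ∀ I : Finset (Fin n), I.card = n - 1 →
        nuI L M n ν (Jset n hn) (proj M n (Jset n hn) '' (F ∩ E)) ≤
          (κ : ℝ≥0∞) * nuI L M n ν I (proj M n I '' (F ∩ E))) :
    0 < ν {b : Fin n → M | ∀ I : Finset (Fin n), I.card = n - 1 →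
      proj M n I b ∈ proj M n I '' E} := by
  classical
  have hprob' : IsProbabilityMeasure ν := ⟨hprob⟩
  let 𝒥 : Finset (Finset (Fin n)) := Finset.univ.filter fun I => I.card = n - 1
  have h𝒥 : ∀ I, I ∈ 𝒥 ↔ I.card = n - 1 := fun I => by simp [𝒥]
  have hJ : Jset n hn ∈ 𝒥 := by
    rw [h𝒥]; simp [Jset, Finset.card_compl]
  let m : OuterMeasure (Fin n → M) := OuterMeasure.restrict E
    (OuterMeasure.comap (proj M n (Jset n hn)) 
      (@Measure.toOuterMeasure _ (defSigma L M _) (nuI L M n ν (Jset n hn))))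
  have hm : ∀ s, m s = nuI L M n ν (Jset n hn) (proj M n (Jset n hn) '' (s ∩ E)) := by
    intro s
    simp [m]
  have hnull : ∀ I ∈ 𝒥, ∀ N, MeasurableSet[cyl L M n I] N → ν N = 0 → m N = 0 := by
    intro I hI N hN h0
    refine null_transfer hprob m κ hκ I (fun s hs => ?_) N hN h0
    rw [hm]
    refine (hc _ (proj_preimage_def I hs) I ((h𝒥 I).1 hI)).trans ?_
    gcongr
    rintro _ ⟨b, ⟨hb1, _⟩, rfl⟩
    exact hb1
  have hmain := abstract_main (ν := ν) (𝓑 := cyl L M n) cyl_le cyl_mono (relIndep hprob hfub) m 𝒥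
    ⟨_, hJ⟩ hnull (fun I => proj M n I ⁻¹' (proj M n I '' E)) (fun I hI =>
      ⟨_, image_meas hsat hE I l (hb I ((h𝒥 I).1 hI)), rfl⟩)
  have hset : (⋂ I ∈ 𝒥, proj M n I ⁻¹' (proj M n I '' E)) = {b : Fin n → M |
      ∀ I : Finset (Fin n), I.card = n - 1 → proj M n I b ∈ proj M n I '' E} := by
    ext b
    simp only [mem_iInter, h𝒥]
    rfl
  rw [hset] at hmain
  by_contra hcon
  have hz : m {x | ¬ ((∀ I ∈ 𝒥, x ∈ proj M n I ⁻¹' (proj M n I '' E)) → 0 < ν {b : Fin n → M |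
      ∀ I : Finset (Fin n), I.card = n - 1 → proj M n I b ∈ proj M n I '' E})} = 0 := hmain
  rw [hm] at hz
  refine ha.ne' (le_antisymm ((measure_mono (image_mono ?_)).trans hz.le) bot_le)
  intro x hx
  refine ⟨?_, hx⟩
  intro h
  exact hcon (h fun I _ => ⟨x, hx, rfl⟩)

end MeasureAmalgamation
end
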